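/- arXiv:1511.09073 — 3 statements merged into one kernel-verified Lean document; each statement's English description precedes it below -/
import Mathlib

section
/- Let L_7 = {K_6 ∪ K_1, S_7, G_1(7), G_2(7), G_3(7), K_5^{+2}}. The maximum number of edges of a P-free 3-graph H on 7 vertices such that H is not contained in any member of L_7 equals 11. -/
/-- A 3-graph: a finite vertex set together with a finite set of edges
(intended to be 3-element subsets of the vertex set). -/
structure ThreeGraph where
  verts : Finset ℕ
  edges : Finset (Finset ℕ)

namespace ThreeGraph

/-- `G` is a genuine 3-uniform hypergraph: every edge is a 3-element subset of the vertex set. -/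
def IsValid (G : ThreeGraph) : Prop :=
  ∀ e ∈ G.edges, e.card = 3 ∧ e ⊆ G.verts

/-- `H.ContainsCopy F` means `F ⊆ H`: there is an injective map of the vertices of `F`
into those of `H` carrying every edge of `F` to an edge of `H`. -/
def ContainsCopy (H F : ThreeGraph) : Prop :=
  ∃ f : ℕ → ℕ, Set.InjOn f ↑F.verts ∧ (∀ v ∈ F.verts, f v ∈ H.verts) ∧
    ∀ e ∈ F.edges, e.image f ∈ H.edges

/-- `H.Free F` : `H` contains no copy of `F`. -/
def Free (H F : ThreeGraph) : Prop := ¬ H.ContainsCopy F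

/-- `IsoCopy F H` : `H` is isomorphic to `F`. -/
def IsoCopy (F H : ThreeGraph) : Prop :=
  ∃ f : ℕ → ℕ, Set.InjOn f ↑F.verts ∧ F.verts.image f = H.verts ∧
    F.edges.image (Finset.image f) = H.edges

/-- Connectivity: any two vertices are joined by a sequence of vertices in which
consecutive ones lie in a common edge. -/
def Connected (G : ThreeGraph) : Prop :=
  ∀ u ∈ G.verts, ∀ v ∈ G.verts,
    Relation.ReflTransGen (fun a b => ∃ e ∈ G.edges, a ∈ e ∧ b ∈ e) u v

/-- Shift all vertices by `k`. -/
def shiftBy (G : ThreeGraph) (k : ℕ) : ThreeGraph :=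
  ⟨G.verts.image (· + k), G.edges.image (Finset.image (· + k))⟩

/-- Vertex-disjoint union of two 3-graphs. -/
def dUnion (G H : ThreeGraph) : ThreeGraph :=
  ⟨G.verts ∪ (H.shiftBy (G.verts.sup id + 1)).verts,
   G.edges ∪ (H.shiftBy (G.verts.sup id + 1)).edges⟩

end ThreeGraph

/-- The loose 3-uniform path of length 3. -/
def pathP : ThreeGraph :=
  ⟨{0,1,2,3,4,5,6}, {{0,1,2},{2,3,4},{4,5,6}}⟩

/-- The triangle `C`. -/
def triangleC : ThreeGraph :=
  ⟨{0,1,2,3,4,5}, {{0,1,2},{2,3,4},{4,5,0}}⟩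

/-- The matching `M`: two disjoint edges. -/
def matchingM : ThreeGraph :=
  ⟨{0,1,2,3,4,5}, {{0,1,2},{3,4,5}}⟩

/-- `P_2`: two edges sharing exactly one vertex. -/
def pairP2 : ThreeGraph :=
  ⟨{0,1,2,3,4}, {{0,1,2},{2,3,4}}⟩

/-- The complete 3-graph `K_n`. -/
def KK (n : ℕ) : ThreeGraph :=
  ⟨Finset.range n, (Finset.range n).powersetCard 3⟩

/-- The full star `S_n` with center `0`. -/
def SS (n : ℕ) : ThreeGraph :=
  ⟨Finset.range n, ((Finset.range n).powersetCard 3).filter (fun e => 0 ∈ e)⟩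

/-- `G_1(n)` with `x,y,z,v = 0,1,2,3`. -/
def G1 (n : ℕ) : ThreeGraph :=
  ⟨Finset.range n,
   insert {0,1,2}
     (((Finset.range n).powersetCard 3).filter
       (fun h => 3 ∈ h ∧ (h ∩ ({0,1,2} : Finset ℕ)).Nonempty))⟩

/-- `G_2(n)` with `x,y,z = 0,1,2`. -/
def G2 (n : ℕ) : ThreeGraph :=
  ⟨Finset.range n,
   insert {0,1,2}
     (((Finset.range n).powersetCard 3).filter
       (fun h => (h ∩ ({0,1,2} : Finset ℕ)).card = 2))⟩

/-- `G_3(n)` with `x,y₁,y₂,z₁,z₂ = 0,1,2,3,4`. -/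
def G3 (n : ℕ) : ThreeGraph :=
  ⟨Finset.range n,
   ((({0,1,2,3,4} : Finset ℕ).powersetCard 3) \ {{1,2,3},{1,2,4}}) ∪
     ((Finset.range n \ ({0,1,2,3,4} : Finset ℕ)).biUnion (fun w => {{0,3,w},{0,4,w}}))⟩

/-- `K_5^{+t}`: `K_5` on `{0,…,4}` with `a,b = 0,1` and `t` pendant edges `{0,1,v}`. -/
def K5plus (t : ℕ) : ThreeGraph :=
  ⟨Finset.range (5 + t),
   ((Finset.range 5).powersetCard 3) ∪ ((Finset.Ico 5 (5 + t)).image (fun v => {0,1,v}))⟩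

/-- The comet `Co(n)`: a `K_4` on `{0,1,2,3}` and a full star on `{0} ∪ {4,…,n-1}`
with center `0`. -/
def comet (n : ℕ) : ThreeGraph :=
  ⟨Finset.range n,
   (({0,1,2,3} : Finset ℕ).powersetCard 3) ∪
     (((insert 0 (Finset.Ico 4 n)).powersetCard 3).filter (fun e => 0 ∈ e))⟩

/-- `W = V(H) \ U`. -/
def Wset (H : ThreeGraph) (U : Finset ℕ) : Finset ℕ := H.verts \ U

/-- `W_0`: the vertices of `W` lying in no edge of `H` entirely contained in `W`. -/
def W0set (H : ThreeGraph) (U : Finset ℕ) : Finset ℕ :=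
  (Wset H U).filter (fun v => ∀ e ∈ H.edges, e ⊆ Wset H U → v ∉ e)

/-- `W_1 = W \ W_0`. -/
def W1set (H : ThreeGraph) (U : Finset ℕ) : Finset ℕ :=
  Wset H U \ W0set H U

/-- `H_1`: the edges of `H` meeting both `U` and `W_1`. -/
def H1set (H : ThreeGraph) (U : Finset ℕ) : Finset (Finset ℕ) :=
  H.edges.filter (fun e => (e ∩ U).Nonempty ∧ (e ∩ W1set H U).Nonempty)

/-- `H[U]`: the edges of `H` entirely contained in `U`. -/
def HUset (H : ThreeGraph) (U : Finset ℕ) : Finset (Finset ℕ) :=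
  H.edges.filter (fun e => e ⊆ U)

/-- The family `L₇`. -/
def L7 : List ThreeGraph := [(KK 6).dUnion (KK 1), SS 7, G1 7, G2 7, G3 7, K5plus 2]

namespace FifthTuran

/-! ### Encoding of triples in `{0,…,6}` as 7-bit numbers, sets of triples as bit masks -/

/-- All triples `a < b < c` in `{0,…,6}`. -/
def triples : List (ℕ × ℕ × ℕ) :=
  [(0, 1, 2), (0, 1, 3), (0, 1, 4), (0, 1, 5), (0, 1, 6), (0, 2, 3), (0, 2, 4), (0, 2, 5), (0, 2,
  6), (0, 3, 4), (0, 3, 5), (0, 3, 6), (0, 4, 5), (0, 4, 6), (0, 5, 6), (1, 2, 3), (1, 2, 4), (1,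
  2, 5), (1, 2, 6), (1, 3, 4), (1, 3, 5), (1, 3, 6), (1, 4, 5), (1, 4, 6), (1, 5, 6), (2, 3, 4),
  (2, 3, 5), (2, 3, 6), (2, 4, 5), (2, 4, 6), (2, 5, 6), (3, 4, 5), (3, 4, 6), (3, 5, 6), (4, 5,
  6)]

/-- The codes `2^a + 2^b + 2^c` of all triples. -/
def cs : List ℕ :=
  [7, 11, 19, 35, 67, 13, 21, 37, 69, 25, 41, 73, 49, 81, 97, 14, 22, 38, 70, 26, 42, 74, 50, 82,
  98, 28, 44, 76, 52, 84, 100, 56, 88, 104, 112]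

/-- The vertex set encoded by a number. -/
def dec (n : ℕ) : Finset ℕ := (Finset.range 7).filter (fun v => n.testBit v = true)

/-- Bit test. -/
def tb (a n : ℕ) : Bool := Nat.beq (Nat.land (Nat.shiftRight a n) 1) 1

/-- Remove a bit. -/
def del (a n : ℕ) : ℕ := Nat.xor a (Nat.land a (2 ^ n))

theorem tb_eq (a n : ℕ) : tb a n = a.testBit n := by
  have h : tb a n = Nat.beq ((a >>> n) &&& 1) 1 := rfl
  rw [h, Nat.testBit, Nat.and_comm 1, Nat.and_one_is_mod]
  rcases Nat.mod_two_eq_zero_or_one (a >>> n) with h | h <;> rw [h] <;> rfl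

theorem tb_del {a n k : ℕ} (h : tb a k = true) (hk : k ≠ n) : tb (del a n) k = true := by
  rw [tb_eq] at *
  change (a ^^^ (a &&& 2 ^ n)).testBit k = true
  rw [Nat.testBit_xor, Nat.testBit_and, Nat.testBit_two_pow, h]
  simp [Ne.symm hk]

/-- The two coded sets share exactly one vertex. -/
def one (i j : ℕ) : Bool :=
  !(Nat.beq (Nat.land i j) 0) && Nat.beq (Nat.land (Nat.land i j) (Nat.land i j - 1)) 0

/-- The two coded sets are disjoint. -/
def disj (i j : ℕ) : Bool := Nat.beq (Nat.land i j) 0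

/-- The three coded triples form a loose path with middle edge `j`. -/
def isP (i j k : ℕ) : Bool := one i j && (one j k && disj i k)

/-- The three coded triples form a loose path (in some order). -/
def forb1 (i e k : ℕ) : Bool := isP i e k || (isP e i k || isP i k e)

/-- The last two coded triples share exactly one vertex. -/
def forb2 (_ e k : ℕ) : Bool := one e k

/-- Certificates for the case analysis: `b e s t` branches on whether the triple `e` is absent (`s`)
or present (`t`); `c` is closed by counting, `l i q` by containment in the `i`-th member of the
family via the vertex map whose values are the decimal digits of `q`. -/
inductive Tr where
  | b (e : ℕ) (s t : Tr)
  | c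
  | l (i q : ℕ)

/-- Remove all triples forbidden by `e` together with a member of `inn`. -/
def rm (forb : ℕ → ℕ → ℕ → Bool) (inn : List ℕ) (e : ℕ) : List ℕ → ℕ → ℕ
  | [], av => av
  | k :: ks, av =>
    rm forb inn e ks (bif tb av k && inn.any (fun i => forb i e k) then del av k else av)

/-- Edge masks of the members of the family. -/
def masks : List ℕ :=
  [78274679833913472, 158458753062771198453921360000, 103892062647321819637888,
    1918461384112476809344, 2427296372760146988247168, 147573952624412092544]

/-- The `v`-th digit. -/
def dig (q v : ℕ) : ℕ := q / 10 ^ v % 10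

/-- Check of a containment leaf. -/
def leafOk (av i q : ℕ) : Bool :=
  Nat.blt i 6 && (decide (((List.range 7).map (dig q)).Nodup) &&
  ((List.range 7).all (fun v => Nat.blt (dig q v) 7) &&
  triples.all (fun t => !(tb av (2 ^ t.1 + 2 ^ t.2.1 + 2 ^ t.2.2)) ||
    tb (masks.getD i 0) (2 ^ dig q t.1 + 2 ^ dig q t.2.1 + 2 ^ dig q t.2.2))))

/-- The certificate checker. -/
def check (forb : ℕ → ℕ → ℕ → Bool) : Tr → ℕ → List ℕ → Bool
  | .b e s t, av, inn =>
    check forb s (del av e) inn && check forb t (rm forb inn e cs av) (e :: inn)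
  | .c, av, _ => Nat.blt (cs.countP (tb av)) 12
  | .l i q, av, _ => leafOk av i q

theorem rm_sound {forb : ℕ → ℕ → ℕ → Bool} {h : ℕ → Prop} {inn : List ℕ} {e : ℕ}
    (hf : ∀ i e k, h i → h e → h k → forb i e k = false)
    (hi : ∀ i ∈ inn, h i) (he : h e) (ks : List ℕ) (av : ℕ)
    (hav : ∀ n, h n → tb av n = true) : ∀ n, h n → tb (rm forb inn e ks av) n = true := by
  induction ks generalizing av with
  | nil => exact hav
  | cons k ks ih =>
    apply ih
    intro n hn
    cases hc : (tb av k && inn.any (fun i => forb i e k)) with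
    | false => exact hav n hn
    | true =>
      refine tb_del (hav n hn) ?_
      rintro rfl
      simp only [Bool.and_eq_true, List.any_eq_true] at hc
      obtain ⟨_, i, hi', hfi⟩ := hc
      rw [hf i e n (hi i hi') he hn] at hfi
      exact absurd hfi (by decide)

theorem check_sound {forb : ℕ → ℕ → ℕ → Bool} {h : ℕ → Prop}
    (hf : ∀ i e k, h i → h e → h k → forb i e k = false)
    (hcnt : ∀ av, (∀ n, h n → tb av n = true) → 12 ≤ cs.countP (tb av))
    (hleaf : ∀ av i q, (∀ n, h n → tb av n = true) → leafOk av i q = false)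
    (t : Tr) (av : ℕ) (inn : List ℕ) (hav : ∀ n, h n → tb av n = true)
    (hi : ∀ i ∈ inn, h i) : check forb t av inn = false := by
  induction t generalizing av inn with
  | c =>
    have := hcnt av hav
    rw [check, Bool.eq_false_iff]
    intro hb
    have := Nat.blt_eq.mp hb
    omega
  | l i q => exact hleaf av i q hav
  | b e s t ihs iht =>
    rw [check]
    by_cases he : h e
    · rw [iht _ (e :: inn) (rm_sound hf hi he cs av hav), Bool.and_false]
      intro i hi'
      rcases List.mem_cons.mp hi' with rfl | hi'
      · exact he
      · exact hi i hi'
    · rw [ihs _ inn _ hi, Bool.false_and]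
      intro n hn
      refine tb_del (hav n hn) ?_
      rintro rfl
      exact he hn

open Tr in
/-- Certificate when two edges `{0,1,2}`, `{2,3,4}` are present. -/
def tree1 : Tr :=
  (b 100 (b 35 (b 67 (b 56 (b 88 (b 41 (b 73 (b 49 (b 81 (b 37 (b 69 (b 42 (b 74 (b 50 (b 82 (b 11
  (b 19 (b 25 (l 2 6521304) (b 38 (b 70 (l 4 6543021) c) (b 70 c c))) (b 44 (b 76 (b 25 (l 4
  6542031) (b 38 (b 70 c c) (b 70 c c))) (l 0 5643210)) (b 76 (l 0 6543210) c))) (b 52 (b 84 (b 19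
  (b 25 (l 4 6524031) (b 38 (b 70 c c) (b 70 c c))) (b 38 (b 70 (l 5 6541032) (l 0 5643210)) (b 70
  (l 0 6543210) (l 5 6543102)))) (l 0 5643210)) (b 84 (l 0 6543210) (l 5 6514032)))) (b 13 (b 11
  (b 25 (b 19 (l 4 2641035) (b 76 (l 3 6524103) c)) (b 52 (l 0 5643210) (b 19 c c))) (b 38 (l 0
  5643210) (b 19 c c))) (l 0 5643210))) (b 13 (b 11 (b 25 (b 44 (l 3 6524103) (b 19 (l 4 6241035)
  c)) (b 38 (b 44 (l 4 6502431) (b 19 c c)) (l 0 6543210))) (b 52 (b 25 (b 44 (l 4 6542301) (b 19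
  c c)) (b 82 (l 0 6543210) c)) (l 0 6543210))) (b 82 (l 0 6543210) (l 5 6514302)))) (b 21 (b 50
  (b 44 (b 38 (l 0 5643210) (b 11 (b 19 (b 13 c c) (b 13 c c)) (b 19 (b 13 c c) (b 13 c c)))) (b
  25 (b 11 (l 4 2614035) (l 3 6542103)) (b 11 c c))) (b 25 (b 44 (b 11 (l 4 2641305) (l 2
  6521034)) (b 11 c c)) (b 44 (b 11 c c) c))) (l 0 5643210))) (b 21 (b 82 (b 76 (b 25 (b 74 (b 70
  (l 0 6543210) (b 11 (b 19 (b 13 c c) (b 13 c c)) (b 19 (b 13 c c) (b 13 c c)))) (b 19 (b 13 (l 4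
  6214305) (l 3 6542103)) (b 13 (l 2 6521034) (l 4 6524301)))) (b 74 (l 0 6543210) (b 19 (b 13 c
  c) (b 13 c c)))) (b 25 (b 52 (l 3 6542103) (l 4 6214035)) (b 52 (l 4 6520431) c))) (b 25 (b 76
  (b 52 (l 2 6521034) (l 4 6241305)) (b 52 (l 4 2614305) c)) (b 76 (b 52 (l 4 6543201) c) (b 11 c
  c)))) (b 74 (l 0 6543210) (l 5 6541302)))) (b 26 (b 44 (b 52 (b 38 (l 0 5643210) (b 11 (b 19 (b
  13 (b 21 c c) (b 21 c c)) (b 13 (b 21 c c) (b 21 c c))) (b 19 (b 13 (b 21 c c) (b 21 c c)) (b 13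
  (b 21 c c) (b 21 c c))))) (b 25 (b 19 (b 13 (l 2 2615304) (l 1 6543021)) (b 13 (l 4 2645031) (l
  2 6524310))) (b 19 (b 13 c c) (b 13 c c)))) (b 11 (b 25 (b 74 (l 1 6543021) (l 2 2651304)) (b 74
  (l 2 6521340) c)) (b 25 (b 21 (l 4 2654031) (l 2 6542310)) (b 21 c c)))) (l 0 5643210))) (b 26
  (b 69 (b 76 (b 84 (b 70 (l 0 6543210) (b 11 (b 19 (b 13 (b 21 c c) (b 21 c c)) (b 13 (b 21 c c)
  (b 21 c c))) (b 19 (b 13 (b 21 c c) (b 21 c c)) (b 13 (b 21 c c) (b 21 c c))))) (b 25 (b 19 (b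
  13 (l 2 6215304) (l 1 6543021)) (b 13 (l 4 6245031) (l 2 6524310))) (b 19 (b 13 c c) (b 13 c
  c)))) (b 11 (b 25 (b 42 (l 1 6543021) (l 2 6251304)) (b 42 (l 2 6521340) c)) (b 25 (b 21 (l 4
  6254031) (l 2 6542310)) (b 21 c c)))) (b 11 (b 19 (b 25 (l 1 6543021) (l 2 6521340)) (b 25 (l 2
  6524310) (l 4 6542013))) (b 19 (b 25 (l 2 6542310) (l 4 6524013)) (b 25 (l 4 6521043) c)))) (b
  69 (l 0 6543210) (l 5 6543120)))) (b 14 (b 37 (b 50 (b 52 (l 0 5643210) (b 19 (b 13 (b 69 (b 25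
  c c) (b 25 c c)) (b 69 (b 25 c c) (b 25 c c))) (b 13 (b 69 (b 25 c c) (b 25 c c)) (b 69 (b 25 c
  c) (b 25 c c))))) (b 11 (b 74 (b 25 (l 4 2605431) (l 2 6534210)) (b 25 c c)) (b 21 (b 25 c c) (b
  25 c c)))) (b 50 (b 11 (b 19 (b 25 (l 2 2615340) (l 4 2641053)) (b 25 (l 4 2645013) (l 3
  6524130))) (b 19 (b 25 c c) (b 25 c c))) (b 11 (b 25 c c) c))) (l 0 5643210))) (b 69 (b 82 (b 42
  (b 81 (b 84 (l 0 6543210) (b 19 (b 13 (b 37 (b 25 c c) (b 25 c c)) (b 37 (b 25 c c) (b 25 c c)))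
  (b 13 (b 37 (b 25 c c) (b 25 c c)) (b 37 (b 25 c c) (b 25 c c))))) (b 14 (b 11 (b 13 (b 37 (l 2
  6534210) (l 4 6205413)) (b 37 (l 4 6502413) (l 3 6524130))) (b 13 (b 37 c c) (b 37 c c))) (l 5
  6514320))) (l 0 6543210)) (b 42 (b 11 (b 38 (l 2 6534210) (l 4 6205431)) (b 38 (l 4 6502143) c))
  (b 11 (b 25 c c) (b 25 c c)))) (b 82 (b 11 (b 81 (b 19 (b 25 (l 2 6215340) (l 4 6241053)) (b 25
  (l 4 6245013) (l 3 6524130))) (l 3 6524130)) (b 81 (b 19 (b 25 c c) (b 25 c c)) (l 4 6542310)))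
  (b 11 (b 38 (l 4 2605413) c) (b 25 c c))))) (b 22 (b 49 (b 42 (b 82 (b 37 (b 44 (l 0 5643210) (b
  11 (b 21 (b 69 (b 25 c c) (b 25 c c)) (b 69 (b 25 c c) (b 25 c c))) (b 21 (b 69 (b 25 c c) (b 25
  c c)) (b 69 (b 25 c c) (b 25 c c))))) (b 19 (b 81 (b 11 (b 25 (l 2 2651340) (l 4 2614053)) (b 25
  (l 4 2654013) (l 3 6542130))) (b 11 (b 25 c c) (b 25 c c))) (b 11 (b 25 (b 81 c c) (b 81 c c))
  (b 25 (b 81 c c) (b 81 c c))))) (l 0 5643210)) (b 37 (b 19 (b 82 (b 25 (l 4 2650431) (l 2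
  6543210)) (b 25 c c)) (b 13 (b 25 c c) (b 25 c c))) (b 19 (b 25 c c) c))) (b 42 (b 82 (b 26 (b
  44 (b 11 (l 4 2641350) (l 2 6521043)) (b 11 c c)) (b 44 (b 11 c c) c)) (b 11 (b 69 c c) (b 69 c
  c))) (b 37 (b 19 c c) c))) (l 0 5643210))) (b 81 (b 74 (b 50 (b 69 (b 76 (b 73 (l 0 6543210) (b
  22 (b 19 (b 21 (b 37 (b 49 c c) (b 49 c c)) (b 37 (b 49 c c) (b 49 c c))) (b 21 (b 37 (b 49 c c)
  (b 49 c c)) (b 37 (b 49 c c) (b 49 c c)))) (l 5 6541320))) (b 73 (b 11 (b 21 (b 37 (b 25 c c) (b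
  25 c c)) (b 37 (b 25 c c) (b 25 c c))) (b 21 (b 37 (b 25 c c) (b 25 c c)) (b 37 (b 25 c c) (b 25
  c c)))) (b 21 (b 37 (l 2 6543210) (l 4 6250413)) (b 37 (l 4 6520413) (l 3 6542130))))) (b 19 (b
  73 (b 49 (b 11 (b 25 (l 2 6251340) (l 4 6214053)) (b 25 (l 4 6254013) (l 3 6542130))) (b 11 (b
  25 c c) (b 25 c c))) (b 49 (l 3 6542130) (l 4 6214350))) (b 73 (b 11 (b 25 (b 49 c c) (b 49 c
  c)) (b 25 (b 49 c c) (b 49 c c))) (b 49 (l 4 6524310) (l 2 6521043))))) (l 0 6543210)) (b 50 (b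
  19 (b 69 (b 38 (l 2 6543210) (l 4 6250431)) (b 38 (l 4 2650413) c)) (b 69 (b 38 (l 4 6520143) c)
  (b 25 c c))) (b 19 (b 25 c c) (b 25 c c)))) (b 74 (b 50 (b 26 (b 76 (b 52 (l 2 6521043) (l 4
  6241350)) (b 52 (l 4 2614350) c)) (b 76 (b 52 (l 4 6543210) c) (b 11 c c))) (b 11 (b 37 c c) (b
  37 c c))) (b 50 (b 19 (b 69 c c) (b 69 c c)) c)))) (b 11 (b 19 (b 37 (b 38 (l 0 5643210) (b 25
  (l 5 4632105) c)) (b 73 (b 81 (b 13 c c) c) (l 5 4632150))) (l 0 5643210)) (l 0 5643210))) (b 69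
  (b 41 (b 49 (b 70 (b 88 (l 0 6543210) (b 11 (b 19 (b 13 c c) c) (l 5 6510432))) (b 25 (b 88 (l 5
  6432105) c) c)) (l 0 6543210)) (l 0 6543210)) (b 41 (b 49 (b 70 (b 26 c c) c) c) (l 5
  6432150)))) (b 56 (b 25 (b 26 (b 88 (b 44 (b 52 (l 0 5643210) (b 11 (l 5 4615032) c)) (b 19 (b
  52 (l 5 4651032) c) c)) (l 0 5643210)) (l 0 5643210)) (l 0 5643210)) (b 11 (b 19 c c) c))) (b 88
  (b 76 (b 41 (b 42 (b 84 (b 67 (l 0 6543210) (b 44 (b 13 (b 14 (b 21 c c) c) (l 5 6543210)) c))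
  (b 11 (b 67 (l 5 6415032) c) c)) (l 0 6543210)) (l 0 6543210)) (b 19 (b 67 (b 84 (l 5 6451032)
  c) c) c)) (b 37 (b 25 (b 11 c c) c) c))) (b 41 (b 73 (b 49 (b 81 (b 42 (b 74 (b 13 (b 50 (b 82
  (l 1 6543021) (l 2 2615304)) (b 82 (l 2 6215304) (l 4 2146035))) (l 1 6543021)) (b 13 (b 50 (b
  82 (l 2 2651304) (l 4 4621035)) (b 82 c c)) (l 2 2651304))) (b 82 (b 74 (b 50 (l 2 6251304) (l 4
  6421035)) (b 50 (l 4 2164035) c)) (b 74 (b 50 c c) (b 50 c c)))) (b 74 (b 13 (b 50 (b 37 (l 4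
  4635021) (l 2 2615340)) (b 37 c c)) (l 2 2615340)) (b 13 (b 69 c c) c))) (b 42 (b 82 (b 81 (b 50
  (l 2 6215340) (l 4 6435021)) (b 50 (l 4 2146053) c)) (b 69 (b 81 c c) (b 81 c c))) (b 13 (b 37 c
  c) c))) (b 49 (b 42 (b 82 (b 81 (b 74 (l 2 2651340) (l 4 4653021)) (b 74 (l 4 4621053) c)) (b 21
  (b 81 c c) (b 81 c c))) (b 37 (b 13 c c) c)) (b 42 (b 82 (b 81 c c) c) c))) (b 81 (b 74 (b 50 (b
  73 (b 49 (b 42 (l 2 6251340) (l 4 6453021)) (b 42 (l 4 6421053) c)) (b 49 (b 42 (l 4 2164053) c)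
  (b 21 c c))) (b 21 (b 49 c c) (b 49 c c))) (b 50 (b 69 (b 73 c c) (b 73 c c)) c)) (b 74 (b 50 (b
  73 (b 49 c c) (b 49 c c)) c) c))))

open Tr in
/-- Certificate when no two edges share exactly one vertex and `{0,1,2}` is present. -/
def tree2 : Tr :=
  (b 11 (b 19 (b 35 (b 67 (b 13 (b 21 c c) c) c) c) c) c)

theorem check1 : check forb1 tree1 (rm forb1 [7] 28 cs (2 ^ 128 - 1)) [28, 7] = true := by
  decide +kernel

theorem check2 : check forb2 tree2 (rm forb2 [7] 7 cs (2 ^ 128 - 1)) [7] = true := by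
  decide +kernel

/-! ### Finite facts about the encoding -/

theorem full_ok : ∀ n ∈ cs, tb (2 ^ 128 - 1) n = true := by decide +kernel

theorem one_ok : ∀ i ∈ cs, ∀ j ∈ cs, one i j = true → (dec i ∩ dec j).card = 1 := by
  decide +kernel

theorem disj_ok : ∀ i ∈ cs, ∀ j ∈ cs, disj i j = true → dec i ∩ dec j = ∅ := by
  decide +kernel

theorem dec_card : ∀ i ∈ cs, (dec i).card = 3 := by decide +kernel

theorem cs_triples : ∀ n ∈ cs, ∃ t ∈ triples, n = 2 ^ t.1 + 2 ^ t.2.1 + 2 ^ t.2.2 ∧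
    dec n = {t.1, t.2.1, t.2.2} ∧ t.1 < 7 ∧ t.2.1 < 7 ∧ t.2.2 < 7 := by decide +kernel

theorem dec_surj : ∀ s ∈ (Finset.range 7).powersetCard 3, ∃ n ∈ cs, dec n = s := by
  decide +kernel

set_option synthInstance.maxHeartbeats 1000000 in
set_option synthInstance.maxSize 10000 in
set_option maxHeartbeats 2000000 in
theorem mask_ok : ∀ i < 6, ∀ x < 7, ∀ y < 7, ∀ z < 7,
    (tb (masks.getD i 0) (2 ^ x + 2 ^ y + 2 ^ z) = true ↔
      ({x, y, z} : Finset ℕ) ∈ (L7.getD i (KK 0)).edges) := by decide +kernel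

theorem verts_ok : ∀ i < 6, (L7.getD i (KK 0)).verts = Finset.range 7 := by decide +kernel

theorem dec_sub (n : ℕ) : dec n ⊆ Finset.range 7 := Finset.filter_subset _ _

theorem dec7 : dec 7 = {0, 1, 2} := by decide +kernel

theorem dec28 : dec 28 = {2, 3, 4} := by decide +kernel

/-! ### The lower bound -/

/-- Boolean bounded quantifier. -/
def allB (n : ℕ) (p : ℕ → Bool) : Bool := (List.range n).all p

/-- Lazy Boolean implication. -/
def imp (a b : Bool) : Bool := bif a then b else true

/-- Boolean disequality. -/
def nb (x y : ℕ) : Bool := !(Nat.beq x y)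

theorem allB_iff (n : ℕ) (p : ℕ → Bool) : allB n p = true ↔ ∀ x < n, p x = true := by
  simp [allB]

theorem imp_iff (a b : Bool) : imp a b = true ↔ (a = true → b = true) := by
  cases a <;> simp [imp]

theorem nb_iff (x y : ℕ) : nb x y = true ↔ x ≠ y := by
  rw [nb, Bool.not_eq_true', Bool.eq_false_iff, Ne, Nat.beq_eq]

/-- The extremal example. -/
def ex11 : ThreeGraph :=
  ⟨Finset.range 7, {{0, 1, 2}, {0, 1, 3}, {0, 1, 4}, {0, 1, 5}, {0, 1, 6}, {0, 2, 3}, {0, 2, 4},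
    {0, 3, 5}, {1, 2, 3}, {1, 2, 5}, {1, 3, 4}}⟩

/-- Its edge mask. -/
def m0 : ℕ := 147573955098007070848

theorem m0_ok : ∀ x < 7, ∀ y < 7, ∀ z < 7, ({x, y, z} : Finset ℕ) ∈ ex11.edges →
    tb m0 (2 ^ x + 2 ^ y + 2 ^ z) = true := by decide +kernel

theorem ex_free_aux_bool : (
    allB 7 fun a =>
    allB 7 fun b =>
    allB 7 fun c =>
    imp (tb m0 (2 ^ a + 2 ^ b + 2 ^ c)) <|
    allB 7 fun d =>
    imp (nb d a) <| imp (nb d b) <| allB 7 fun e =>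
    imp (nb e a) <| imp (nb e b) <| imp (tb m0 (2 ^ c + 2 ^ d + 2 ^ e)) <|
    allB 7 fun f =>
    imp (nb f a) <| imp (nb f b) <| imp (nb f c) <| imp (nb f d) <| allB 7 fun g =>
    imp (nb g a) <| imp (nb g b) <| imp (nb g c) <| imp (nb g d) <| imp (tb m0 (2 ^ e + 2 ^ f + 2 ^ g)) <|
    false) = true := by decide +kernel

theorem ex_free_aux : ∀ a < 7, ∀ b < 7, ∀ c < 7, tb m0 (2 ^ a + 2 ^ b + 2 ^ c) = true →
    ∀ d < 7, d ≠ a → d ≠ b → ∀ e < 7, e ≠ a → e ≠ b → tb m0 (2 ^ c + 2 ^ d + 2 ^ e) = true →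
    ∀ f < 7, f ≠ a → f ≠ b → f ≠ c → f ≠ d → ∀ g < 7, g ≠ a → g ≠ b → g ≠ c → g ≠ d →
    tb m0 (2 ^ e + 2 ^ f + 2 ^ g) = true → False := by
  have h := ex_free_aux_bool
  simpa only [allB_iff, imp_iff, nb_iff, Bool.false_eq_true] using h

theorem ex_emb_aux_bool : (
    allB 6 fun i =>
    allB 7 fun u =>
    allB 7 fun v =>
    imp (nb v u) <| allB 7 fun w =>
    imp (nb w u) <| imp (nb w v) <| imp (tb (masks.getD i 0) (2^u+2^v+2^w)) <|
    allB 7 fun x =>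
    imp (nb x u) <| imp (nb x v) <| imp (nb x w) <| imp (tb (masks.getD i 0) (2^u+2^v+2^x)) <|
    imp (tb (masks.getD i 0) (2^u+2^w+2^x)) <|
    imp (tb (masks.getD i 0) (2^v+2^w+2^x)) <|
    allB 7 fun y =>
    imp (nb y u) <| imp (nb y v) <| imp (nb y w) <| imp (nb y x) <| imp (tb (masks.getD i 0) (2^u+2^v+2^y)) <|
    imp (tb (masks.getD i 0) (2^u+2^w+2^y)) <|
    imp (tb (masks.getD i 0) (2^v+2^x+2^y)) <|
    allB 7 fun z =>
    imp (nb z u) <| imp (nb z v) <| imp (nb z w) <| imp (nb z x) <| imp (nb z y) <| imp (tb (masks.getD i 0) (2^u+2^v+2^z)) <|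
    imp (tb (masks.getD i 0) (2^u+2^x+2^z)) <|
    imp (tb (masks.getD i 0) (2^v+2^w+2^z)) <|
    allB 7 fun t =>
    imp (nb t u) <| imp (nb t v) <| imp (nb t w) <| imp (nb t x) <| imp (nb t y) <| imp (nb t z) <| imp (tb (masks.getD i 0) (2^u+2^v+2^t)) <|
    false) = true := by decide +kernel

theorem ex_emb_aux : ∀ i < 6, ∀ u < 7, ∀ v < 7, v ≠ u → ∀ w < 7, w ≠ u → w ≠ v →
    tb (masks.getD i 0) (2^u+2^v+2^w) = true →
    ∀ x < 7, x ≠ u → x ≠ v → x ≠ w → tb (masks.getD i 0) (2^u+2^v+2^x) = true →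
    tb (masks.getD i 0) (2^u+2^w+2^x) = true → tb (masks.getD i 0) (2^v+2^w+2^x) = true →
    ∀ y < 7, y ≠ u → y ≠ v → y ≠ w → y ≠ x → tb (masks.getD i 0) (2^u+2^v+2^y) = true →
    tb (masks.getD i 0) (2^u+2^w+2^y) = true → tb (masks.getD i 0) (2^v+2^x+2^y) = true →
    ∀ z < 7, z ≠ u → z ≠ v → z ≠ w → z ≠ x → z ≠ y →
    tb (masks.getD i 0) (2^u+2^v+2^z) = true →
    tb (masks.getD i 0) (2^u+2^x+2^z) = true → tb (masks.getD i 0) (2^v+2^w+2^z) = true →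
    ∀ t < 7, t ≠ u → t ≠ v → t ≠ w → t ≠ x → t ≠ y → t ≠ z →
    tb (masks.getD i 0) (2^u+2^v+2^t) = true → False := by
  have h := ex_emb_aux_bool
  simpa only [allB_iff, imp_iff, nb_iff, Bool.false_eq_true] using h

theorem ex_free : ex11.Free pathP := by
  rintro ⟨f, hinj, hv, he⟩
  have hlt : ∀ v, v < 7 → f v < 7 := by
    intro v hv'
    have : v ∈ pathP.verts := by
      have : pathP.verts = Finset.range 7 := by decide +kernel
      rw [this]; simpa using hv'
    simpa [ex11] using hv v this
  have hne : ∀ u v, u < 7 → v < 7 → u ≠ v → f u ≠ f v := by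
    intro u v hu hv' huv h
    have hr : pathP.verts = Finset.range 7 := by decide +kernel
    rw [hr] at hinj
    exact huv (hinj (by simpa using hu) (by simpa using hv') h)
  have key : ∀ x y z, x < 7 → y < 7 → z < 7 → ({x, y, z} : Finset ℕ) ∈ pathP.edges →
      tb m0 (2 ^ f x + 2 ^ f y + 2 ^ f z) = true := by
    intro x y z hx hy hz h
    have := he _ h
    simp only [Finset.image_insert, Finset.image_singleton] at this
    exact m0_ok _ (hlt x hx) _ (hlt y hy) _ (hlt z hz) this
  exact ex_free_aux (f 0) (hlt 0 (by decide)) (f 1) (hlt 1 (by decide)) (f 2) (hlt 2 (by decide))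
    (key 0 1 2 (by decide) (by decide) (by decide) (by decide))
    (f 3) (hlt 3 (by decide)) (hne _ _ (by decide) (by decide) (by decide))
    (hne _ _ (by decide) (by decide) (by decide))
    (f 4) (hlt 4 (by decide)) (hne _ _ (by decide) (by decide) (by decide))
    (hne _ _ (by decide) (by decide) (by decide))
    (key 2 3 4 (by decide) (by decide) (by decide) (by decide))
    (f 5) (hlt 5 (by decide)) (hne _ _ (by decide) (by decide) (by decide))
    (hne _ _ (by decide) (by decide) (by decide)) (hne _ _ (by decide) (by decide) (by decide))
    (hne _ _ (by decide) (by decide) (by decide))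
    (f 6) (hlt 6 (by decide)) (hne _ _ (by decide) (by decide) (by decide))
    (hne _ _ (by decide) (by decide) (by decide)) (hne _ _ (by decide) (by decide) (by decide))
    (hne _ _ (by decide) (by decide) (by decide))
    (key 4 5 6 (by decide) (by decide) (by decide) (by decide))

theorem ex_emb (i : ℕ) (hi : i < 6) : ¬ (L7.getD i (KK 0)).ContainsCopy ex11 := by
  rintro ⟨f, hinj, hv, he⟩
  have hlt : ∀ v, v < 7 → f v < 7 := by
    intro v hv'
    have := hv v (by simpa [ex11] using hv')
    rw [verts_ok i hi] at this
    simpa using this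
  have hne : ∀ u v, u < 7 → v < 7 → u ≠ v → f u ≠ f v := by
    intro u v hu hv' huv h
    exact huv (hinj (by simpa [ex11] using hu) (by simpa [ex11] using hv') h)
  have key : ∀ x y z, x < 7 → y < 7 → z < 7 → ({x, y, z} : Finset ℕ) ∈ ex11.edges →
      tb (masks.getD i 0) (2 ^ f x + 2 ^ f y + 2 ^ f z) = true := by
    intro x y z hx hy hz h
    have := he _ h
    simp only [Finset.image_insert, Finset.image_singleton] at this
    exact (mask_ok i hi _ (hlt x hx) _ (hlt y hy) _ (hlt z hz)).mpr this
  refine ex_emb_aux i hi (f 0) (hlt 0 (by decide)) (f 1) (hlt 1 (by decide)) ?_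
    (f 2) (hlt 2 (by decide)) ?_ ?_ (key 0 1 2 ?_ ?_ ?_ ?_)
    (f 3) (hlt 3 (by decide)) ?_ ?_ ?_ (key 0 1 3 ?_ ?_ ?_ ?_) (key 0 2 3 ?_ ?_ ?_ ?_)
    (key 1 2 3 ?_ ?_ ?_ ?_)
    (f 4) (hlt 4 (by decide)) ?_ ?_ ?_ ?_ (key 0 1 4 ?_ ?_ ?_ ?_) (key 0 2 4 ?_ ?_ ?_ ?_)
    (key 1 3 4 ?_ ?_ ?_ ?_)
    (f 5) (hlt 5 (by decide)) ?_ ?_ ?_ ?_ ?_ (key 0 1 5 ?_ ?_ ?_ ?_) (key 0 3 5 ?_ ?_ ?_ ?_)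
    (key 1 2 5 ?_ ?_ ?_ ?_)
    (f 6) (hlt 6 (by decide)) ?_ ?_ ?_ ?_ ?_ ?_ (key 0 1 6 ?_ ?_ ?_ ?_) <;>
  first
    | decide
    | exact hne _ _ (by decide) (by decide) (by decide)

/-! ### The upper bound -/

theorem exists_sigma (l : List ℕ) (hl : l.length = 7) (hnd : l.Nodup) :
    Set.InjOn (fun n => l.getD n 0) ↑(Finset.range 7) ∧
    (Finset.range 7).image (fun n => l.getD n 0) = l.toFinset := by
  constructor
  · intro x hx y hy h
    simp only [Finset.coe_range, Set.mem_Iio] at hx hy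
    simp only at h
    rw [List.getD_eq_getElem _ _ (by omega), List.getD_eq_getElem _ _ (by omega)] at h
    exact (List.Nodup.getElem_inj_iff hnd).mp h
  · ext v
    simp only [Finset.mem_image, Finset.mem_range, List.mem_toFinset]
    constructor
    · rintro ⟨n, hn, rfl⟩
      rw [List.getD_eq_getElem _ _ (by omega)]
      exact List.getElem_mem _
    · intro hv
      obtain ⟨n, hn, rfl⟩ := List.mem_iff_getElem.mp hv
      exact ⟨n, by omega, List.getD_eq_getElem _ _ hn⟩

/-- Structure of two triples sharing exactly one vertex. -/
theorem pair_struct {A B : Finset ℕ} (hA : A.card = 3) (hB : B.card = 3)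
    (h : (A ∩ B).card = 1) : ∃ a b c d e, A = {a, b, c} ∧ B = {c, d, e} ∧
      [a, b, c, d, e].Nodup := by
  obtain ⟨c, hc⟩ := Finset.card_eq_one.mp h
  have hcA : c ∈ A := (Finset.mem_inter.mp (hc ▸ Finset.mem_singleton_self c)).1
  have hcB : c ∈ B := (Finset.mem_inter.mp (hc ▸ Finset.mem_singleton_self c)).2
  obtain ⟨a, b, hab, hA'⟩ := Finset.card_eq_two.mp
    (show (A.erase c).card = 2 by rw [Finset.card_erase_of_mem hcA, hA])
  obtain ⟨d, e, hde, hB'⟩ := Finset.card_eq_two.mp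
    (show (B.erase c).card = 2 by rw [Finset.card_erase_of_mem hcB, hB])
  have eA : A = {a, b, c} := by
    rw [← Finset.insert_erase hcA, hA']; ext v; simp; tauto
  have eB : B = {c, d, e} := by
    rw [← Finset.insert_erase hcB, hB']
  have ha : a ∈ A.erase c := by rw [hA']; simp
  have hb : b ∈ A.erase c := by rw [hA']; simp
  have hd : d ∈ B.erase c := by rw [hB']; simp
  have he : e ∈ B.erase c := by rw [hB']; simp
  rw [Finset.mem_erase] at ha hb hd he
  have key : ∀ x, x ∈ A → x ∈ B → x = c := by
    intro x h1 h2
    have : x ∈ A ∩ B := Finset.mem_inter.mpr ⟨h1, h2⟩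
    rw [hc] at this
    simpa using this
  refine ⟨a, b, c, d, e, eA, eB, ?_⟩
  have h1 : a ≠ d := fun h => ha.1 (key a ha.2 (h ▸ hd.2))
  have h2 : a ≠ e := fun h => ha.1 (key a ha.2 (h ▸ he.2))
  have h3 : b ≠ d := fun h => hb.1 (key b hb.2 (h ▸ hd.2))
  have h4 : b ≠ e := fun h => hb.1 (key b hb.2 (h ▸ he.2))
  have h5 := ha.1
  have h6 := hb.1
  have h7 := hd.1.symm
  have h8 := he.1.symm
  simp [*]

/-- Three edges pairwise meeting as in a loose path give a copy of `P`. -/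
theorem path_copy {H : ThreeGraph} (hval : H.IsValid) {A B C : Finset ℕ} (hA : A ∈ H.edges)
    (hB : B ∈ H.edges) (hC : C ∈ H.edges) (h1 : (A ∩ B).card = 1) (h2 : (B ∩ C).card = 1)
    (h3 : A ∩ C = ∅) : H.ContainsCopy pathP := by
  obtain ⟨a, b, c, d, e, rfl, rfl, hnd⟩ := pair_struct (hval A hA).1 (hval B hB).1 h1
  obtain ⟨x, hx⟩ := Finset.card_eq_one.mp h2
  have hxm : x ∈ ({c, d, e} : Finset ℕ) ∩ C := hx ▸ Finset.mem_singleton_self x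
  rw [Finset.mem_inter] at hxm
  have hdis : ∀ v ∈ ({a, b, c} : Finset ℕ), v ∉ C := fun v hv hv' => by
    have : v ∈ ({a, b, c} : Finset ℕ) ∩ C := Finset.mem_inter.mpr ⟨hv, hv'⟩
    rw [h3] at this
    simp at this
  have hcC : c ∉ C := hdis c (by simp)
  obtain ⟨d', e', hB', hnd', he'C, hd'C⟩ : ∃ d' e', ({c, d, e} : Finset ℕ) = {c, d', e'} ∧
      [a, b, c, d', e'].Nodup ∧ e' ∈ C ∧ d' ∉ C := by
    have huniq : ∀ v ∈ ({c, d, e} : Finset ℕ), v ∈ C → v = x := fun v hv hv' => by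
      have : v ∈ ({c, d, e} : Finset ℕ) ∩ C := Finset.mem_inter.mpr ⟨hv, hv'⟩
      rw [hx] at this
      simpa using this
    have hde : d ≠ e := by
      intro h; simp [h] at hnd
    rcases (by simpa using hxm.1 : x = c ∨ x = d ∨ x = e) with h | h | h
    · exact absurd (h ▸ hxm.2) hcC
    · refine ⟨e, d, by ext v; simp; tauto, ?_, h ▸ hxm.2, ?_⟩
      · have : ([a, b, c] ++ [e, d]).Nodup :=
          ((List.Perm.swap d e []).append_left [a, b, c]).nodup_iff.mpr hnd
        exact this
      · intro h'
        exact hde (((huniq e (by simp) h').trans h).symm)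
    · refine ⟨d, e, rfl, hnd, h ▸ hxm.2, ?_⟩
      intro h'
      exact hde ((huniq d (by simp) h').trans h)
  rw [hB'] at hB
  obtain ⟨f, g, hfg, hC'⟩ := Finset.card_eq_two.mp
    (show (C.erase e').card = 2 by rw [Finset.card_erase_of_mem he'C, (hval C hC).1])
  have eC : C = {e', f, g} := by rw [← Finset.insert_erase he'C, hC']
  have hf : f ∈ C.erase e' := by rw [hC']; simp
  have hg : g ∈ C.erase e' := by rw [hC']; simp
  rw [Finset.mem_erase] at hf hg
  have hne : ∀ u v, u ∉ C → v ∈ C → u ≠ v := fun u v h h' h'' => h (h'' ▸ h')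
  have haC := hdis a (by simp)
  have hbC := hdis b (by simp)
  have hall : [a, b, c, d', e', f, g].Nodup := by
    have k1 := hne a f haC hf.2
    have k2 := hne a g haC hg.2
    have k3 := hne b f hbC hf.2
    have k4 := hne b g hbC hg.2
    have k5 := hne c f hcC hf.2
    have k6 := hne c g hcC hg.2
    have k7 := hne d' f hd'C hf.2
    have k8 := hne d' g hd'C hg.2
    have k9 := hf.1.symm
    have k10 := hg.1.symm
    simp only [List.nodup_cons, List.mem_cons, List.not_mem_nil, or_false, not_or,
      not_false_eq_true, List.nodup_nil, and_true] at hnd' ⊢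
    tauto
  obtain ⟨s1, s2⟩ := exists_sigma _ rfl hall
  have hr : pathP.verts = Finset.range 7 := by decide +kernel
  refine ⟨_, by rw [hr]; exact s1, ?_, ?_⟩
  · intro v hv
    rw [hr] at hv
    have hv' := Finset.mem_image_of_mem (fun n => [a, b, c, d', e', f, g].getD n 0) hv
    rw [s2] at hv'
    have hA' := (hval _ hA).2
    have hB'' := (hval _ hB).2
    have hC'' := (hval _ hC).2
    rw [eC] at hC''
    simp only [List.mem_toFinset, List.mem_cons, List.not_mem_nil, or_false] at hv'
    rcases hv' with h | h | h | h | h | h | h <;> rw [h]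
    · exact hA' (by simp)
    · exact hA' (by simp)
    · exact hA' (by simp)
    · exact hB'' (by simp)
    · exact hB'' (by simp)
    · exact hC'' (by simp)
    · exact hC'' (by simp)
  · intro s hs
    simp only [pathP, Finset.mem_insert, Finset.mem_singleton] at hs
    rw [eC] at hC
    rcases hs with rfl | rfl | rfl
    · simpa using hA
    · simpa using hB
    · simpa using hC

section upper

variable {H : ThreeGraph} {σ : ℕ → ℕ}

/-- The triple coded by `n` is an edge of `H` (transported along `σ`). -/
def hh (H : ThreeGraph) (σ : ℕ → ℕ) (n : ℕ) : Prop := n ∈ cs ∧ (dec n).image σ ∈ H.edges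

theorem edge_code (hval : H.IsValid) (hinj : Set.InjOn σ ↑(Finset.range 7))
    (him : (Finset.range 7).image σ = H.verts) {e : Finset ℕ} (he : e ∈ H.edges) :
    ∃ n, hh H σ n ∧ (dec n).image σ = e := by
  obtain ⟨h3, hsub⟩ := hval e he
  rw [← him] at hsub
  obtain ⟨s, hs, rfl⟩ := Finset.subset_image_iff.mp hsub
  have hs' : s ⊆ Finset.range 7 := by exact_mod_cast hs
  have hc : s.card = 3 := by
    rw [← h3, Finset.card_image_of_injOn (hinj.mono (by exact_mod_cast hs'))]
  obtain ⟨n, hn, rfl⟩ := dec_surj s (Finset.mem_powersetCard.mpr ⟨hs', hc⟩)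
  exact ⟨n, ⟨hn, he⟩, rfl⟩

theorem count_ok (hval : H.IsValid) (hinj : Set.InjOn σ ↑(Finset.range 7))
    (him : (Finset.range 7).image σ = H.verts) (hcard : 12 ≤ H.edges.card) (av : ℕ)
    (hav : ∀ n, hh H σ n → tb av n = true) : 12 ≤ cs.countP (tb av) := by
  have hsub : H.edges ⊆ ((cs.filter (tb av)).toFinset).image (fun n => (dec n).image σ) := by
    intro e he
    obtain ⟨n, hn, rfl⟩ := edge_code hval hinj him he
    refine Finset.mem_image.mpr ⟨n, ?_, rfl⟩
    rw [List.mem_toFinset, List.mem_filter]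
    exact ⟨hn.1, hav n hn⟩
  calc 12 ≤ H.edges.card := hcard
    _ ≤ _ := Finset.card_le_card hsub
    _ ≤ _ := Finset.card_image_le
    _ ≤ _ := List.toFinset_card_le _
    _ = _ := (List.countP_eq_length_filter).symm

theorem inter_card (hinj : Set.InjOn σ ↑(Finset.range 7)) (i j : ℕ) :
    ((dec i).image σ) ∩ ((dec j).image σ) = (dec i ∩ dec j).image σ ∧
    ((dec i ∩ dec j).image σ).card = (dec i ∩ dec j).card := by
  constructor
  · rw [Finset.image_inter_of_injOn]
    exact hinj.mono (by
      rw [← Finset.coe_union]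
      exact_mod_cast Finset.union_subset (dec_sub i) (dec_sub j))
  · exact Finset.card_image_of_injOn (hinj.mono (by
      exact_mod_cast Finset.inter_subset_left.trans (dec_sub i)))

theorem isP_false (hval : H.IsValid) (hfree : H.Free pathP)
    (hinj : Set.InjOn σ ↑(Finset.range 7)) (i j k : ℕ)
    (hi : hh H σ i) (hj : hh H σ j) (hk : hh H σ k) : isP i j k = false := by
  rw [Bool.eq_false_iff]
  intro h
  simp only [isP, Bool.and_eq_true] at h
  obtain ⟨h1, h2, h3⟩ := h
  refine hfree (path_copy hval hi.2 hj.2 hk.2 ?_ ?_ ?_)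
  · rw [(inter_card hinj i j).1, (inter_card hinj i j).2]
    exact one_ok i hi.1 j hj.1 h1
  · rw [(inter_card hinj j k).1, (inter_card hinj j k).2]
    exact one_ok j hj.1 k hk.1 h2
  · rw [(inter_card hinj i k).1, disj_ok i hi.1 k hk.1 h3, Finset.image_empty]

theorem leaf_ok (hval : H.IsValid) (hinj : Set.InjOn σ ↑(Finset.range 7))
    (him : (Finset.range 7).image σ = H.verts)
    (hno : ∀ i < 6, ¬ (L7.getD i (KK 0)).ContainsCopy H) (av i q : ℕ)
    (hav : ∀ n, hh H σ n → tb av n = true) : leafOk av i q = false := by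
  rw [Bool.eq_false_iff]
  intro h
  simp only [leafOk, Bool.and_eq_true, decide_eq_true_eq, List.all_eq_true, Nat.blt_eq,
    List.mem_range] at h
  obtain ⟨hi, hnd, hlt, hall⟩ := h
  have hq : Set.InjOn (dig q) ↑(Finset.range 7) := by
    intro x hx y hy hxy
    simp only [Finset.coe_range, Set.mem_Iio] at hx hy
    exact List.inj_on_of_nodup_map hnd (List.mem_range.mpr hx) (List.mem_range.mpr hy) hxy
  have hinv : ∀ v ∈ Finset.range 7, Function.invFunOn σ ↑(Finset.range 7) (σ v) = v := by
    intro v hv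
    exact hinj.leftInvOn_invFunOn (by exact_mod_cast hv)
  refine hno i hi ⟨fun w => dig q (Function.invFunOn σ ↑(Finset.range 7) w), ?_, ?_, ?_⟩
  · rw [← him]
    intro x hx y hy hxy
    simp only [Finset.coe_image, Set.mem_image] at hx hy
    obtain ⟨x, hx, rfl⟩ := hx
    obtain ⟨y, hy, rfl⟩ := hy
    simp only [hinv x (by exact_mod_cast hx), hinv y (by exact_mod_cast hy)] at hxy
    rw [hq hx hy hxy]
  · rw [← him, verts_ok i hi]
    intro v hv
    obtain ⟨x, hx, rfl⟩ := Finset.mem_image.mp hv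
    simp only [hinv x hx]
    exact Finset.mem_range.mpr (hlt x (Finset.mem_range.mp hx))
  · intro e he
    obtain ⟨n, hn, rfl⟩ := edge_code hval hinj him he
    obtain ⟨t, ht, hnt, hdec, ha, hb, hc⟩ := cs_triples n hn.1
    have h1 := hall t ht
    rw [← hnt, hav n hn] at h1
    simp only [Bool.not_true, Bool.false_or] at h1
    have h2 := (mask_ok i hi _ (hlt _ ha) _ (hlt _ hb) _ (hlt _ hc)).mp h1
    rw [hdec]
    simp only [Finset.image_insert, Finset.image_singleton]
    rw [hinv _ (Finset.mem_range.mpr ha), hinv _ (Finset.mem_range.mpr hb),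
      hinv _ (Finset.mem_range.mpr hc)]
    exact h2

end upper

theorem upper (H : ThreeGraph) (hval : H.IsValid) (h7 : H.verts.card = 7)
    (hfree : H.Free pathP) (hno : ∀ i < 6, ¬ (L7.getD i (KK 0)).ContainsCopy H) :
    H.edges.card ≤ 11 := by
  by_contra hcon
  have hcard : 12 ≤ H.edges.card := by omega
  by_cases hp : ∃ A ∈ H.edges, ∃ B ∈ H.edges, (A ∩ B).card = 1
  · obtain ⟨A, hA, B, hB, hAB⟩ := hp
    obtain ⟨a, b, c, d, e, rfl, rfl, hnd⟩ := pair_struct (hval A hA).1 (hval B hB).1 hAB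
    have hsub : ([a, b, c, d, e].toFinset) ⊆ H.verts := by
      intro v hv
      have h1 := (hval _ hA).2
      have h2 := (hval _ hB).2
      simp only [List.mem_toFinset, List.mem_cons, List.not_mem_nil, or_false] at hv
      rcases hv with h | h | h | h | h <;> rw [h]
      · exact h1 (by simp)
      · exact h1 (by simp)
      · exact h1 (by simp)
      · exact h2 (by simp)
      · exact h2 (by simp)
    have hl : (([a, b, c, d, e] ++ (H.verts \ [a, b, c, d, e].toFinset).toList)).length = 7 := by
      rw [List.length_append, Finset.length_toList, Finset.card_sdiff_of_subset hsub, h7,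
        List.toFinset_card_of_nodup hnd]
      rfl
    have hn : (([a, b, c, d, e] ++ (H.verts \ [a, b, c, d, e].toFinset).toList)).Nodup := by
      refine List.Nodup.append hnd (Finset.nodup_toList _) ?_
      intro v hv hv'
      rw [Finset.mem_toList, Finset.mem_sdiff, List.mem_toFinset] at hv'
      exact hv'.2 hv
    obtain ⟨s1, s2⟩ := exists_sigma _ hl hn
    have him : (Finset.range 7).image (fun n =>
        ([a, b, c, d, e] ++ (H.verts \ [a, b, c, d, e].toFinset).toList).getD n 0) = H.verts := by
      rw [s2, List.toFinset_append, Finset.toList_toFinset, Finset.union_sdiff_of_subset hsub]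
    clear s2
    have h7' : hh H (fun n =>
        ([a, b, c, d, e] ++ (H.verts \ [a, b, c, d, e].toFinset).toList).getD n 0) 7 := by
      refine ⟨by decide, ?_⟩
      rw [dec7]
      simpa using hA
    have h28 : hh H (fun n =>
        ([a, b, c, d, e] ++ (H.verts \ [a, b, c, d, e].toFinset).toList).getD n 0) 28 := by
      refine ⟨by decide, ?_⟩
      rw [dec28]
      simpa using hB
    generalize (fun n =>
      ([a, b, c, d, e] ++ (H.verts \ [a, b, c, d, e].toFinset).toList).getD n 0) = σ at *
    have hf : ∀ i e k, hh H σ i → hh H σ e → hh H σ k → forb1 i e k = false := by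
      intro i e k hi he hk
      rw [forb1, isP_false hval hfree s1 _ _ _ hi he hk, isP_false hval hfree s1 _ _ _ he hi hk,
        isP_false hval hfree s1 _ _ _ hi hk he]
      rfl
    have := check_sound hf (count_ok hval s1 him hcard) (leaf_ok hval s1 him hno) tree1
      (rm forb1 [7] 28 cs (2 ^ 128 - 1)) [28, 7]
      (rm_sound hf (by simpa using h7') h28 cs _ (fun n hn => full_ok n hn.1))
      (by simpa using ⟨h28, h7'⟩)
    rw [check1] at this
    exact absurd this (by decide)
  · push Not at hp
    obtain ⟨A, hA⟩ := Finset.card_pos.mp (show 0 < H.edges.card by omega)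
    obtain ⟨a, b, c, hab, hac, hbc, rfl⟩ := Finset.card_eq_three.mp (hval A hA).1
    have hnd : [a, b, c].Nodup := by simp [*]
    have hsub : ([a, b, c].toFinset) ⊆ H.verts := by
      simpa using (hval _ hA).2
    have hl : (([a, b, c] ++ (H.verts \ [a, b, c].toFinset).toList)).length = 7 := by
      rw [List.length_append, Finset.length_toList, Finset.card_sdiff_of_subset hsub, h7,
        List.toFinset_card_of_nodup hnd]
      rfl
    have hn : (([a, b, c] ++ (H.verts \ [a, b, c].toFinset).toList)).Nodup := by
      refine List.Nodup.append hnd (Finset.nodup_toList _) ?_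
      intro v hv hv'
      rw [Finset.mem_toList, Finset.mem_sdiff, List.mem_toFinset] at hv'
      exact hv'.2 hv
    obtain ⟨s1, s2⟩ := exists_sigma _ hl hn
    have him : (Finset.range 7).image (fun n =>
        ([a, b, c] ++ (H.verts \ [a, b, c].toFinset).toList).getD n 0) = H.verts := by
      rw [s2, List.toFinset_append, Finset.toList_toFinset, Finset.union_sdiff_of_subset hsub]
    clear s2
    have h7' : hh H (fun n =>
        ([a, b, c] ++ (H.verts \ [a, b, c].toFinset).toList).getD n 0) 7 := by
      refine ⟨by decide, ?_⟩
      rw [dec7]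
      simpa using hA
    generalize (fun n =>
      ([a, b, c] ++ (H.verts \ [a, b, c].toFinset).toList).getD n 0) = σ at *
    have hf : ∀ i e k, hh H σ i → hh H σ e → hh H σ k → forb2 i e k = false := by
      intro i e k _ he hk
      rw [forb2, Bool.eq_false_iff]
      intro h
      refine hp _ he.2 _ hk.2 ?_
      rw [(inter_card s1 e k).1, (inter_card s1 e k).2]
      exact one_ok e he.1 k hk.1 h
    have := check_sound hf (count_ok hval s1 him hcard) (leaf_ok hval s1 him hno) tree2
      (rm forb2 [7] 7 cs (2 ^ 128 - 1)) [7]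
      (rm_sound hf (by simpa using h7') h7' cs _ (fun n hn => full_ok n hn.1))
      (by simpa using h7')
    rw [check2] at this
    exact absurd this (by decide)

theorem mem_L7_iff (p : ThreeGraph → Prop) :
    (∀ G ∈ L7, p G) ↔ ∀ i < 6, p (L7.getD i (KK 0)) := by
  constructor
  · intro h i hi
    have hi' : i < L7.length := hi
    rw [List.getD_eq_getElem _ _ hi']
    exact h _ (List.getElem_mem _)
  · intro h G hG
    obtain ⟨i, hi, rfl⟩ := List.mem_iff_getElem.mp hG
    have := h i hi
    rwa [List.getD_eq_getElem _ _ hi] at this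

end FifthTuran

/-- The maximum number of edges of a `P`-free 3-graph on 7 vertices not contained
in any member of `L₇` equals 11. -/
theorem fifth_order_turan_seven :
    IsGreatest {m : ℕ | ∃ H : ThreeGraph, H.IsValid ∧ H.verts.card = 7 ∧
      H.Free pathP ∧ (∀ G ∈ L7, ¬ G.ContainsCopy H) ∧ H.edges.card = m} 11 := by
  constructor
  · refine ⟨FifthTuran.ex11, ?_, by decide +kernel, FifthTuran.ex_free, ?_, by decide +kernel⟩
    · have : ∀ e ∈ FifthTuran.ex11.edges, e.card = 3 ∧ e ⊆ FifthTuran.ex11.verts := by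
        decide +kernel
      exact this
    · exact (FifthTuran.mem_L7_iff (fun G => ¬ G.ContainsCopy FifthTuran.ex11)).mpr
        FifthTuran.ex_emb
  · rintro m ⟨H, hval, h7, hfree, hno, rfl⟩
    exact FifthTuran.upper H hval h7 hfree
      ((FifthTuran.mem_L7_iff (fun G => ¬ G.ContainsCopy H)).mp hno)
end

section
/- Let L_8 = {S_8, K_6 ∪ K_2, G_1(8), G_2(8), G_3(8)}. The maximum number of edges of a P-free 3-graph H on 8 vertices such that H is not contained in any member of L_8 equals 13; moreover such an H has 13 edges if and only if H is isomorphic to K_5^{+3}. -/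
/-- The family `L₈`. -/
def L8 : List ThreeGraph := [SS 8, (KK 6).dUnion (KK 2), G1 8, G2 8, G3 8]


/-! ### Encoding of triples of labels `0,…,7` by 8-bit masks -/

/-- The set of labels encoded by a mask. -/
def bitsOf (m : ℕ) : Finset ℕ := (Finset.range 8).filter (fun i => m.testBit i = true)

/-- Exactly one bit set. -/
def one1 (x : ℕ) : Bool := !(Nat.beq x 0) && Nat.beq (Nat.land x (x - 1)) 0

def pth (a b c : ℕ) : Bool :=
  Nat.beq (Nat.land a c) 0 && (one1 (Nat.land a b) && one1 (Nat.land b c))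

/-- Three masks form a loose path, in some order. -/
def isPm (a b c : ℕ) : Bool := pth a b c || (pth b a c || pth a c b)

/-- Three masks form a loose triangle. -/
def isCm (a b c : ℕ) : Bool :=
  one1 (Nat.land a b) && (one1 (Nat.land b c) && (one1 (Nat.land a c) &&
    Nat.beq (Nat.land a (Nat.land b c)) 0))

def triplesM : List ℕ :=
  (List.range 256).filter (fun m => Nat.beq ((List.range 8).countP (fun i => m.testBit i)) 3)

/-- Certificates of the case analysis. -/
inductive CTree where
  | cnt : CTree
  | cov : ℕ → List ℕ → CTree
  | br : ℕ → CTree → CTree → CTree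

/-- All triples of labels, increasing. -/
def allT : List (ℕ × ℕ × ℕ) :=
  (List.range 8).flatMap fun i => (List.range 8).flatMap fun j => (List.range 8).filterMap fun k =>
    if i < j ∧ j < k then some (i, j, k) else none

def famG : ℕ → ThreeGraph
  | 0 => SS 8
  | 1 => (KK 6).dUnion (KK 2)
  | 2 => G1 8
  | 3 => G2 8
  | 4 => G3 8
  | _ => K5plus 3

/-- Edges of the six target graphs, as increasing triples. -/
def famT : ℕ → List (ℕ × ℕ × ℕ)
  | 0 => allT.filter fun t => t.1 == 0
  | 1 => allT.filter fun t => Nat.blt t.2.2 6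
  | 2 => allT.filter fun t => (t.2.2 == 2) || (Nat.blt t.1 3 && (t.2.1 == 3 || t.2.2 == 3))
  | 3 => allT.filter fun t => Nat.blt t.2.1 3
  | 4 => allT.filter fun t =>
      (Nat.blt t.2.2 5 && !(t.1 == 1 && t.2.1 == 2)) ||
        (Nat.blt 4 t.2.2 && (t.1 == 0 && (t.2.1 == 3 || t.2.1 == 4)))
  | _ => allT.filter fun t => Nat.blt t.2.2 5 || (t.1 == 0 && t.2.1 == 1)

def maskT (i j k : ℕ) : ℕ := Nat.lor (2 ^ i) (Nat.lor (2 ^ j) (2 ^ k))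

def covCheck (k : ℕ) (τ : List ℕ) (av : List ℕ) : Bool :=
  (Nat.beq τ.length 8 && (τ.all (fun i => Nat.blt i 8) && decide τ.Nodup)) &&
    av.all fun m => (famT k).any fun t =>
      Nat.beq (maskT (τ.getD t.1 0) (τ.getD t.2.1 0) (τ.getD t.2.2 0)) m

/-- The certificate checker: `inn` are edges known to be present, `av` are the edges which
may be present. -/
def chk (bad : ℕ → ℕ → ℕ → Bool) : CTree → List ℕ → List ℕ → Bool
  | .cnt, _, av => Nat.blt av.length 13
  | .cov k τ, _, av => covCheck k τ av
  | .br e l r, inn, av =>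
      chk bad l (e :: inn) (av.filter fun f => inn.all fun g => !(bad e f g)) &&
      chk bad r inn (av.filter fun f => !(Nat.beq f e))

def chk0 (bad : ℕ → ℕ → ℕ → Bool) (t : CTree) (inn : List ℕ) : Bool :=
  chk bad t inn (triplesM.filter fun f => inn.all fun e => inn.all fun g => !(bad e f g))

theorem chk_sound (bad : ℕ → ℕ → ℕ → Bool) (p : ℕ → Prop)
    (hbad : ∀ e f g, p e → p f → p g → bad e f g = true → False) :
    ∀ (t : CTree) (inn av : List ℕ), chk bad t inn av = true → (∀ m ∈ inn, p m) →
      (∀ m, p m → m ∈ av) →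
      ∃ av' : List ℕ, (∀ m, p m → m ∈ av') ∧
        (av'.length < 13 ∨ ∃ k τ, covCheck k τ av' = true) := by
  intro t
  induction t with
  | cnt =>
    intro inn av h _ hav
    exact ⟨av, hav, Or.inl (by simpa [chk, Nat.blt] using h)⟩
  | cov k τ =>
    intro inn av h _ hav
    exact ⟨av, hav, Or.inr ⟨k, τ, h⟩⟩
  | br e l r ihl ihr =>
    intro inn av h hin hav
    rw [chk, Bool.and_eq_true] at h
    by_cases he : p e
    · refine ihl _ _ h.1 ?_ ?_
      · intro m hm
        rcases List.mem_cons.1 hm with rfl | hm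
        · exact he
        · exact hin m hm
      · intro m hm
        rw [List.mem_filter]
        refine ⟨hav m hm, ?_⟩
        rw [List.all_eq_true]
        intro g hg
        cases hb : bad e m g with
        | false => rfl
        | true => exact (hbad e m g he hm (hin g hg) hb).elim
    · refine ihr _ _ h.2 hin ?_
      intro m hm
      rw [List.mem_filter]
      refine ⟨hav m hm, ?_⟩
      cases hb : Nat.beq m e with
      | false => rfl
      | true => exact (he (Nat.eq_of_beq_eq_true hb ▸ hm)).elim

theorem chk0_sound (bad : ℕ → ℕ → ℕ → Bool) (p : ℕ → Prop)
    (hbad : ∀ e f g, p e → p f → p g → bad e f g = true → False)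
    (hp : ∀ m, p m → m ∈ triplesM)
    (t : CTree) (inn : List ℕ) (h : chk0 bad t inn = true) (hin : ∀ m ∈ inn, p m) :
      ∃ av' : List ℕ, (∀ m, p m → m ∈ av') ∧
        (av'.length < 13 ∨ ∃ k τ, covCheck k τ av' = true) := by
  refine chk_sound bad p hbad t inn _ h hin ?_
  intro m hm
  rw [List.mem_filter]
  refine ⟨hp m hm, ?_⟩
  rw [List.all_eq_true]
  intro e he
  rw [List.all_eq_true]
  intro g hg
  cases hb : bad e m g with
  | false => rfl
  | true => exact (hbad e m g (hin e he) hm (hin g hg) hb).elim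

/-! ### The certificates -/

open CTree in
def treeC : CTree :=
  (br 14 (br 81 (cov 5 [0, 4, 1, 2, 3, 5, 6, 7])
  (br 145 cnt
  (cov 1 [0, 1, 2, 3, 4, 5, 6, 7])))
  (br 35 (br 84 (cov 5 [2, 4, 0, 1, 5, 3, 6, 7])
  (br 148 cnt
  (cov 1 [0, 1, 2, 3, 4, 5, 6, 7])))
  (br 56 (br 69 (cov 5 [0, 2, 3, 4, 5, 1, 6, 7])
  (br 133 cnt
  (cov 1 [0, 1, 2, 3, 4, 5, 6, 7])))
  (br 73 (br 42 (br 82 cnt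
  (br 100 cnt
  (br 19 (br 26 cnt
  cnt)
  (br 26 cnt
  cnt))))
  (br 82 (br 100 cnt
  (br 11 (br 26 cnt
  cnt)
  (br 26 cnt
  cnt)))
  (br 100 (br 41 (br 44 cnt
  cnt)
  (br 44 cnt
  cnt))
  (br 26 (br 44 (br 84 cnt
  cnt)
  (br 84 cnt
  (cov 4 [0, 1, 2, 3, 4, 5, 6, 7])))
  (br 44 (br 84 cnt
  (cov 4 [0, 4, 5, 2, 3, 1, 6, 7]))
  (br 84 (cov 4 [0, 3, 6, 2, 4, 1, 5, 7])
  (cov 2 [2, 3, 4, 0, 1, 5, 6, 7])))))))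
  (br 82 (br 42 (br 100 cnt
  (br 11 (br 25 cnt
  cnt)
  (br 25 cnt
  cnt)))
  (br 100 (br 38 (br 50 cnt
  cnt)
  (br 50 cnt
  cnt))
  (br 11 (br 38 (br 69 cnt
  cnt)
  (br 69 cnt
  (cov 4 [4, 2, 3, 0, 1, 5, 6, 7])))
  (br 38 (br 69 cnt
  (cov 4 [4, 0, 5, 1, 2, 3, 6, 7]))
  (br 69 (cov 4 [4, 1, 6, 0, 2, 3, 5, 7])
  (cov 2 [0, 1, 2, 4, 3, 5, 6, 7]))))))
  (br 100 (br 42 (br 13 (br 22 cnt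
  cnt)
  (br 22 cnt
  cnt))
  (br 41 (br 50 (br 81 cnt
  cnt)
  (br 81 cnt
  (cov 4 [2, 3, 4, 0, 5, 1, 6, 7])))
  (br 50 (br 81 cnt
  (cov 4 [2, 0, 1, 4, 5, 3, 6, 7]))
  (br 81 (cov 4 [2, 5, 6, 0, 4, 1, 3, 7])
  (cov 2 [0, 4, 5, 2, 1, 3, 6, 7])))))
  (br 42 (br 137 (br 146 cnt
  (br 164 cnt
  (br 19 cnt
  cnt)))
  (br 146 (br 164 cnt
  (br 11 cnt
  cnt))
  (br 164 (br 13 cnt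
  cnt)
  (cov 1 [0, 1, 2, 3, 4, 5, 6, 7]))))
  (br 137 (br 146 (br 164 cnt
  (br 11 (br 26 cnt
  cnt)
  (br 26 cnt
  cnt)))
  (br 164 (br 41 (br 44 cnt
  cnt)
  (br 44 cnt
  cnt))
  (br 26 (br 44 cnt
  (br 148 cnt
  (cov 4 [0, 1, 2, 3, 4, 5, 6, 7])))
  (br 44 (br 148 cnt
  (cov 4 [0, 4, 5, 2, 3, 1, 6, 7]))
  (br 148 (cov 4 [0, 3, 7, 2, 4, 1, 5, 6])
  (cov 2 [2, 3, 4, 0, 1, 5, 6, 7]))))))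
  (br 146 (br 164 (br 38 (br 50 cnt
  cnt)
  (br 50 cnt
  cnt))
  (br 11 (br 38 cnt
  (br 133 cnt
  (cov 4 [4, 2, 3, 0, 1, 5, 6, 7])))
  (br 38 (br 133 cnt
  (cov 4 [4, 0, 5, 1, 2, 3, 6, 7]))
  (br 133 (cov 4 [4, 1, 7, 0, 2, 3, 5, 6])
  (cov 2 [0, 1, 2, 4, 3, 5, 6, 7])))))
  (br 164 (br 41 (br 50 cnt
  (br 145 cnt
  (cov 4 [2, 3, 4, 0, 5, 1, 6, 7])))
  (br 50 (br 145 cnt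
  (cov 4 [2, 0, 1, 4, 5, 3, 6, 7]))
  (br 145 (cov 4 [2, 5, 7, 0, 4, 1, 3, 6])
  (cov 2 [0, 4, 5, 2, 1, 3, 6, 7]))))
  (br 11 (br 52 (cov 1 [0, 1, 2, 3, 4, 5, 6, 7])
  (br 26 (br 81 (br 13 (br 22 cnt
  cnt)
  (br 22 cnt
  cnt))
  (br 145 (br 13 cnt
  cnt)
  (cov 1 [0, 1, 2, 3, 4, 5, 6, 7])))
  (br 38 (br 25 (cov 1 [0, 1, 2, 3, 4, 5, 6, 7])
  (br 50 (cov 1 [0, 1, 2, 3, 4, 5, 6, 7])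
  (br 13 (br 19 (br 44 cnt
  (br 21 (br 22 (br 41 cnt
  cnt)
  cnt)
  cnt))
  (br 21 (br 22 (br 41 cnt
  cnt)
  cnt)
  cnt))
  (br 19 (br 44 cnt
  cnt)
  cnt))))
  (br 44 (br 19 (cov 1 [0, 1, 2, 3, 4, 5, 6, 7])
  (br 50 cnt
  (br 13 (br 21 (br 22 (br 41 cnt
  cnt)
  cnt)
  cnt)
  cnt)))
  (br 50 (br 13 cnt
  (br 19 (br 21 (br 22 (br 41 cnt
  cnt)
  cnt)
  cnt)
  cnt))
  (br 13 (br 19 (br 21 (br 22 (br 41 cnt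
  (cov 4 [0, 1, 3, 2, 4, 5, 6, 7]))
  (cov 2 [2, 3, 4, 0, 1, 5, 6, 7]))
  (br 22 (br 41 cnt
  (cov 4 [0, 1, 3, 2, 4, 5, 6, 7]))
  (cov 2 [2, 3, 4, 0, 1, 5, 6, 7])))
  (br 21 (br 22 (br 41 cnt
  (cov 4 [0, 1, 3, 2, 4, 5, 6, 7]))
  (cov 2 [2, 3, 4, 0, 1, 5, 6, 7]))
  (br 22 (br 41 cnt
  cnt)
  cnt)))
  (br 19 (br 21 (br 22 (br 41 cnt
  (cov 4 [0, 1, 3, 2, 4, 5, 6, 7]))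
  (cov 2 [2, 3, 4, 0, 1, 5, 6, 7]))
  (br 22 (br 41 cnt
  cnt)
  cnt))
  (br 21 (br 22 (br 41 cnt
  cnt)
  cnt)
  cnt))))))))
  (br 26 (br 37 (cov 1 [0, 1, 2, 3, 4, 5, 6, 7])
  (br 38 (br 25 (cov 1 [0, 1, 2, 3, 4, 5, 6, 7])
  (br 41 (cov 1 [0, 1, 2, 3, 4, 5, 6, 7])
  (br 13 (br 50 cnt
  (br 19 (br 44 cnt
  cnt)
  cnt))
  (br 19 (br 44 cnt
  cnt)
  cnt))))
  (br 41 (br 22 (cov 1 [0, 1, 2, 3, 4, 5, 6, 7])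
  (br 44 cnt
  (br 13 (br 50 cnt
  cnt)
  cnt)))
  (br 44 (br 19 cnt
  (br 13 (br 50 cnt
  cnt)
  cnt))
  (br 13 (br 50 cnt
  (cov 4 [4, 1, 3, 0, 2, 5, 6, 7]))
  (cov 2 [0, 1, 2, 4, 3, 5, 6, 7]))))))
  (br 38 (br 25 (cov 1 [0, 1, 2, 3, 4, 5, 6, 7])
  (br 41 (br 22 (cov 1 [0, 1, 2, 3, 4, 5, 6, 7])
  (br 50 cnt
  (br 13 (br 19 (br 44 cnt
  cnt)
  cnt)
  cnt)))
  (br 50 (br 13 cnt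
  (br 19 (br 44 cnt
  cnt)
  cnt))
  (br 13 (br 19 (br 44 cnt
  (cov 4 [2, 1, 5, 0, 4, 3, 6, 7]))
  (cov 2 [0, 4, 5, 2, 1, 3, 6, 7]))
  (br 19 (br 44 cnt
  (cov 4 [2, 1, 5, 0, 4, 3, 6, 7]))
  (cov 2 [0, 4, 5, 2, 1, 3, 6, 7]))))))
  (br 41 (br 22 (cov 1 [0, 1, 2, 3, 4, 5, 6, 7])
  (br 44 (br 19 cnt
  (br 50 cnt
  cnt))
  (br 50 (br 13 cnt
  cnt)
  (cov 4 [0, 3, 5, 2, 4, 1, 6, 7]))))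
  (br 44 (br 19 cnt
  (br 50 (br 13 cnt
  cnt)
  (cov 4 [2, 3, 5, 0, 4, 1, 6, 7])))
  (br 50 (br 13 cnt
  (cov 4 [4, 1, 5, 0, 2, 3, 6, 7]))
  (cov 3 [0, 2, 4, 1, 3, 5, 6, 7])))))))))))))))))

open CTree in
def treeQ : CTree :=
  (br 224 (br 35 cnt
  (br 56 cnt
  (br 67 cnt
  (br 88 cnt
  (br 131 cnt
  (br 152 cnt
  (br 100 cnt
  (br 164 cnt
  cnt))))))))
  (br 11 (br 44 (br 52 cnt
  (br 56 cnt
  cnt))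
  (br 76 (br 140 cnt
  cnt)
  (br 140 cnt
  (br 52 (br 13 cnt
  (br 14 cnt
  (br 56 cnt
  cnt)))
  (br 56 (br 13 cnt
  (br 14 cnt
  cnt))
  (br 84 (br 13 cnt
  (br 14 cnt
  cnt))
  (br 88 (br 13 cnt
  cnt)
  (br 148 (br 13 cnt
  cnt)
  (br 152 cnt
  (cov 5 [0, 1, 2, 3, 4, 5, 6, 7]))))))))))
  (br 19 (br 52 (br 44 cnt
  cnt)
  (br 84 cnt
  (br 148 cnt
  (br 44 (br 56 cnt
  (br 21 cnt
  cnt))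
  (br 56 (br 21 cnt
  cnt)
  (br 76 (br 21 cnt
  cnt)
  (br 88 cnt
  (br 140 cnt
  (br 152 cnt
  cnt)))))))))
  (br 25 (br 14 (br 21 cnt
  (br 13 (br 38 cnt
  cnt)
  cnt))
  (br 22 (br 13 cnt
  cnt)
  (br 35 (br 13 cnt
  (br 21 cnt
  cnt))
  (br 37 (br 38 cnt
  cnt)
  (br 38 cnt
  (br 67 (br 13 cnt
  cnt)
  (br 69 cnt
  (br 70 cnt
  cnt))))))))
  (br 26 (br 13 (br 22 cnt
  cnt)
  (br 21 cnt
  (br 35 (br 14 cnt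
  cnt)
  (br 37 cnt
  (br 38 cnt
  (br 67 cnt
  (br 69 cnt
  cnt)))))))
  (br 35 (br 196 cnt
  (br 56 cnt
  (br 88 cnt
  (br 152 cnt
  (br 13 (br 21 cnt
  cnt)
  (br 14 cnt
  (br 44 cnt
  (br 76 cnt
  (br 140 cnt
  cnt)))))))))
  (br 56 (br 196 cnt
  (br 67 cnt
  (br 131 cnt
  (br 13 (br 14 cnt
  cnt)
  (br 14 cnt
  (br 21 cnt
  (br 22 cnt
  (br 37 cnt
  cnt))))))))
  (br 67 (br 152 cnt
  (br 88 cnt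
  (br 164 cnt
  (br 13 cnt
  (br 14 cnt
  (br 76 cnt
  (br 44 cnt
  cnt)))))))
  (br 88 (br 131 cnt
  (br 164 cnt
  (br 13 cnt
  (br 14 cnt
  (br 21 cnt
  (br 22 cnt
  cnt))))))
  (br 131 (br 152 cnt
  (br 100 cnt
  (br 13 cnt
  (br 14 cnt
  (br 140 cnt
  cnt)))))
  (br 152 (br 100 cnt
  (br 13 cnt
  (br 14 cnt
  (br 21 cnt
  cnt))))
  (cov 0 [2, 0, 1, 3, 4, 5, 6, 7]))))))))))))

open CTree in
def treeS : CTree :=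
  (br 11 cnt
  (br 13 cnt
  (br 14 cnt
  (br 19 cnt
  (br 21 cnt
  (br 22 cnt
  (br 224 cnt
  (br 35 cnt
  (br 37 cnt
  (br 38 cnt
  (br 200 cnt
  (br 208 cnt
  (br 67 cnt
  (br 69 cnt
  cnt))))))))))))))

def badQ (a b c : ℕ) : Bool := isPm a b c || isCm a b c

def badS (a b _c : ℕ) : Bool := one1 (Nat.land a b)

set_option maxRecDepth 100000 in
theorem chkC : chk0 isPm treeC [7, 28, 49] = true := by decide +kernel

set_option maxRecDepth 100000 in
theorem chkQ : chk0 badQ treeQ [7, 28] = true := by decide +kernel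

set_option maxRecDepth 100000 in
theorem chkS : chk0 badS treeS [7] = true := by decide +kernel

/-! ### Finite facts -/

theorem one1_card : ∀ x < 256, one1 x = true → (bitsOf x).card = 1 := by decide +kernel

theorem triplesM_lt : ∀ m ∈ triplesM, m < 256 := by decide +kernel

theorem triplesM_surj : ∀ T ∈ (Finset.range 8).powersetCard 3, ∃ m ∈ triplesM, bitsOf m = T := by
  decide +kernel

theorem bits_mask : ∀ i < 8, ∀ j < 8, ∀ k < 8, bitsOf (maskT i j k) = {i, j, k} := by
  decide +kernel

theorem famT_lt : ∀ k < 6, ∀ t ∈ famT k, t.1 < 8 ∧ t.2.1 < 8 ∧ t.2.2 < 8 := by decide +kernel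

theorem famT_mem : ∀ k < 6, ∀ t ∈ famT k, ({t.1, t.2.1, t.2.2} : Finset ℕ) ∈ (famG k).edges := by
  decide +kernel

theorem famG_verts : ∀ k < 6, (famG k).verts = Finset.range 8 := by decide +kernel

theorem K5_card : (K5plus 3).edges.card = 13 := by decide +kernel

theorem K5_valid : (K5plus 3).IsValid := by
  unfold ThreeGraph.IsValid
  decide +kernel

theorem K5_noP : ∀ A ∈ (K5plus 3).edges, ∀ B ∈ (K5plus 3).edges, ∀ C ∈ (K5plus 3).edges,
    A ∩ C = ∅ → (A ∩ B).card = 1 → (B ∩ C).card = 1 → False := by decide +kernel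

/-- No `K_5`. -/
def NoK5 (E : Finset (Finset ℕ)) : Prop :=
  ∀ a ∈ Finset.range 8, ∀ b ∈ Finset.range 8, ∀ c ∈ Finset.range 8, ({a, b, c} : Finset ℕ) ∈ E →
    ∀ d ∈ Finset.range 8, ({a, b, d} : Finset ℕ) ∈ E → ({a, c, d} : Finset ℕ) ∈ E →
      ({b, c, d} : Finset ℕ) ∈ E →
    ∀ e ∈ Finset.range 8, ({a, b, e} : Finset ℕ) ∈ E → ({a, c, e} : Finset ℕ) ∈ E →
      ({b, c, e} : Finset ℕ) ∈ E → ({a, d, e} : Finset ℕ) ∈ E →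
      ({b, d, e} : Finset ℕ) ∈ E → ({c, d, e} : Finset ℕ) ∈ E → False

set_option synthInstance.maxSize 4000 in
set_option synthInstance.maxHeartbeats 400000 in
instance (E : Finset (Finset ℕ)) : Decidable (NoK5 E) := by
  unfold NoK5
  infer_instance

theorem noK5_0 : NoK5 (SS 8).edges := by decide +kernel
theorem noK5_2 : NoK5 (G1 8).edges := by decide +kernel
theorem noK5_3 : NoK5 (G2 8).edges := by decide +kernel
theorem noK5_4 : NoK5 (G3 8).edges := by decide +kernel

theorem K6_edges : ∀ e ∈ ((KK 6).dUnion (KK 2)).edges, e ⊆ Finset.range 6 := by decide +kernel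

/-! ### Labelings -/

theorem getD_injOn (L : List ℕ) (hL : L.Nodup) :
    Set.InjOn (fun i => L.getD i 0) (↑(Finset.range L.length) : Set ℕ) := by
  intro i hi j hj h
  have hi' : i < L.length := by simpa using hi
  have hj' : j < L.length := by simpa using hj
  simp only [List.getD_eq_getElem _ _ hi', List.getD_eq_getElem _ _ hj'] at h
  exact (List.Nodup.getElem_inj_iff hL).1 h

theorem getD_image (L : List ℕ) :
    (Finset.range L.length).image (fun i => L.getD i 0) = L.toFinset := by
  ext x
  simp only [Finset.mem_image, Finset.mem_range, List.mem_toFinset]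
  constructor
  · rintro ⟨i, hi, rfl⟩
    rw [List.getD_eq_getElem _ _ hi]
    exact List.getElem_mem hi
  · intro hx
    obtain ⟨i, hi, rfl⟩ := List.getElem_of_mem hx
    exact ⟨i, hi, List.getD_eq_getElem _ _ hi⟩

theorem extend_list (V : Finset ℕ) (l : List ℕ) (hl : l.Nodup) (hlV : ∀ x ∈ l, x ∈ V) :
    ∃ l' : List ℕ, (l ++ l').Nodup ∧ (l ++ l').length = V.card ∧ (l ++ l').toFinset = V := by
  have hnd : (l ++ (V \ l.toFinset).toList).Nodup := by
    refine List.Nodup.append hl (Finset.nodup_toList _) ?_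
    intro x hx hx'
    simp only [Finset.mem_toList, Finset.mem_sdiff, List.mem_toFinset] at hx'
    exact hx'.2 hx
  have hV : (l ++ (V \ l.toFinset).toList).toFinset = V := by
    ext x
    simp only [List.toFinset_append, Finset.mem_union, List.mem_toFinset, Finset.mem_toList,
      Finset.mem_sdiff]
    constructor
    · rintro (h | h)
      · exact hlV x h
      · exact h.1
    · intro h
      by_cases hx : x ∈ l
      · exact Or.inl hx
      · exact Or.inr ⟨h, hx⟩
  refine ⟨_, hnd, ?_, hV⟩
  rw [← List.toFinset_card_of_nodup hnd, hV]

/-- `Good G H`: a bijection of labels exhibiting `H` as a spanning subgraph of `G`. -/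
def GoodEmb (G H : ThreeGraph) : Prop :=
  ∃ ψ : ℕ → ℕ, Set.InjOn ψ (↑(Finset.range 8) : Set ℕ) ∧ (Finset.range 8).image ψ = H.verts ∧
    H.edges ⊆ G.edges.image (Finset.image ψ)

theorem and_lt (a b : ℕ) (ha : a < 256) : Nat.land a b < 256 :=
  lt_of_le_of_lt Nat.and_le_left ha

theorem bits_land (a b : ℕ) : bitsOf (Nat.land a b) = bitsOf a ∩ bitsOf b := by
  have h : Nat.land a b = a &&& b := rfl
  rw [h]
  ext i
  simp only [bitsOf, Finset.mem_filter, Finset.mem_inter, Nat.testBit_and, Bool.and_eq_true]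
  tauto

theorem bits_sub (a : ℕ) : bitsOf a ⊆ Finset.range 8 := Finset.filter_subset _ _

section labeled

theorem S_inter (φ : ℕ → ℕ) (hφ : Set.InjOn φ (↑(Finset.range 8) : Set ℕ)) (a b : ℕ) :
    (bitsOf a).image φ ∩ (bitsOf b).image φ = (bitsOf (Nat.land a b)).image φ := by
  rw [bits_land, Finset.image_inter_of_injOn]
  intro x hx y hy h
  refine hφ ?_ ?_ h
  · rcases hx with hx | hx
    · exact bits_sub a hx
    · exact bits_sub b hx
  · rcases hy with hx | hx
    · exact bits_sub a hx
    · exact bits_sub b hx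

theorem S_card (φ : ℕ → ℕ) (hφ : Set.InjOn φ (↑(Finset.range 8) : Set ℕ)) (a : ℕ) :
    ((bitsOf a).image φ).card = (bitsOf a).card :=
  Finset.card_image_of_injOn (hφ.mono (by exact_mod_cast bits_sub a))

theorem S_one (φ : ℕ → ℕ) (hφ : Set.InjOn φ (↑(Finset.range 8) : Set ℕ)) (a b : ℕ)
    (ha : a < 256) (h : one1 (Nat.land a b) = true) :
    ((bitsOf a).image φ ∩ (bitsOf b).image φ).card = 1 := by
  rw [S_inter φ hφ, S_card φ hφ]
  exact one1_card _ (and_lt a b ha) h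

theorem bits_zero : bitsOf 0 = ∅ := by decide +kernel

theorem S_zero (φ : ℕ → ℕ) (hφ : Set.InjOn φ (↑(Finset.range 8) : Set ℕ)) (a b : ℕ)
    (h : Nat.beq (Nat.land a b) 0 = true) :
    (bitsOf a).image φ ∩ (bitsOf b).image φ = ∅ := by
  rw [S_inter φ hφ, Nat.eq_of_beq_eq_true h, bits_zero, Finset.image_empty]

end labeled

/-! ### Extracting configurations -/

theorem card3 {A : Finset ℕ} (hA : A.card = 3) {x y : ℕ} (hx : x ∈ A) (hy : y ∈ A) (h : x ≠ y) :
    ∃ z, z ≠ x ∧ z ≠ y ∧ A = {x, z, y} := by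
  have h1 : ((A.erase x).erase y).card = 1 := by
    rw [Finset.card_erase_of_mem (Finset.mem_erase.2 ⟨h.symm, hy⟩), Finset.card_erase_of_mem hx, hA]
  obtain ⟨z, hz⟩ := Finset.card_eq_one.1 h1
  have hz' : z ∈ (A.erase x).erase y := by rw [hz]; simp
  simp only [Finset.mem_erase] at hz'
  refine ⟨z, hz'.2.1, hz'.1, ?_⟩
  ext v
  have := Finset.ext_iff.1 hz v
  simp only [Finset.mem_erase, Finset.mem_singleton] at this
  simp only [Finset.mem_insert, Finset.mem_singleton]
  grind

theorem card3' {A : Finset ℕ} (hA : A.card = 3) {x : ℕ} (hx : x ∈ A) :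
    ∃ y z, y ≠ x ∧ z ≠ x ∧ y ≠ z ∧ A = {y, z, x} := by
  have h1 : (A.erase x).card = 2 := by
    rw [Finset.card_erase_of_mem hx, hA]
  obtain ⟨y, z, hyz, hz⟩ := Finset.card_eq_two.1 h1
  refine ⟨y, z, ?_, ?_, hyz, ?_⟩
  · have : y ∈ A.erase x := by rw [hz]; simp
    exact (Finset.mem_erase.1 this).1
  · have : z ∈ A.erase x := by rw [hz]; simp
    exact (Finset.mem_erase.1 this).1
  · ext v
    have := Finset.ext_iff.1 hz v
    simp only [Finset.mem_erase, Finset.mem_singleton, Finset.mem_insert] at this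
    simp only [Finset.mem_insert, Finset.mem_singleton]
    grind

theorem one_mem {A B : Finset ℕ} (h : (A ∩ B).card = 1) :
    ∃ x, x ∈ A ∧ x ∈ B ∧ ∀ v, v ∈ A → v ∈ B → v = x := by
  obtain ⟨x, hx⟩ := Finset.card_eq_one.1 h
  have h1 : x ∈ A ∩ B := by rw [hx]; simp
  refine ⟨x, (Finset.mem_inter.1 h1).1, (Finset.mem_inter.1 h1).2, ?_⟩
  intro v hA hB
  have : v ∈ A ∩ B := Finset.mem_inter.2 ⟨hA, hB⟩
  rw [hx] at this
  simpa using this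

theorem contains_path (H : ThreeGraph) (hv : H.IsValid) (A B C : Finset ℕ) (hA : A ∈ H.edges)
    (hB : B ∈ H.edges) (hC : C ∈ H.edges) (hAC : A ∩ C = ∅) (hAB : (A ∩ B).card = 1)
    (hBC : (B ∩ C).card = 1) : H.ContainsCopy pathP := by
  obtain ⟨x, hxA, hxB, hx⟩ := one_mem hAB
  obtain ⟨y, hyB, hyC, hy⟩ := one_mem hBC
  have hd : ∀ v, v ∈ A → v ∈ C → False := by
    intro v h1 h2
    have : v ∈ A ∩ C := Finset.mem_inter.2 ⟨h1, h2⟩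
    rw [hAC] at this
    simp at this
  have hxy : x ≠ y := fun h => hd x hxA (h ▸ hyC)
  obtain ⟨d, hd1, hd2, hBe⟩ := card3 (hv B hB).1 hxB hyB hxy
  obtain ⟨a, b, ha, hb, hab, hAe⟩ := card3' (hv A hA).1 hxA
  obtain ⟨f, g, hf, hg, hfg, hCe⟩ := card3' (hv C hC).1 hyC
  have hnd : [a, b, x, d, y, f, g].Nodup := by
    have e1 : ∀ v, v ∈ A ↔ v = a ∨ v = b ∨ v = x := by intro v; rw [hAe]; simp
    have e2 : ∀ v, v ∈ B ↔ v = x ∨ v = d ∨ v = y := by intro v; rw [hBe]; simp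
    have e3 : ∀ v, v ∈ C ↔ v = f ∨ v = g ∨ v = y := by intro v; rw [hCe]; simp
    simp only [List.nodup_cons, List.mem_cons, List.not_mem_nil, or_false, not_or,
      List.nodup_nil, and_true, not_false_eq_true]
    clear hAe hBe hCe hAC hAB hBC
    have m1 : a ∈ A := (e1 a).2 (by simp)
    have m2 : b ∈ A := (e1 b).2 (by simp)
    have m3 : d ∈ B := (e2 d).2 (by simp)
    have m4 : f ∈ C := (e3 f).2 (by simp)
    have m5 : g ∈ C := (e3 g).2 (by simp)
    clear e1 e2 e3
    refine ⟨⟨?_, ?_, ?_, ?_, ?_, ?_⟩, ⟨?_, ?_, ?_, ?_, ?_⟩, ⟨?_, ?_, ?_, ?_⟩, ⟨?_, ?_, ?_⟩,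
      ⟨?_, ?_⟩, ?_⟩ <;> grind
  have hinj := getD_injOn _ hnd
  refine ⟨fun i => [a, b, x, d, y, f, g].getD i 0, ?_, ?_, ?_⟩
  · refine hinj.mono ?_
    intro i hi
    simp [pathP] at hi ⊢
    omega
  · have hA' := (hv A hA).2
    have hB' := (hv B hB).2
    have hC' := (hv C hC).2
    rw [hAe] at hA'
    rw [hBe] at hB'
    rw [hCe] at hC'
    simp only [Finset.insert_subset_iff, Finset.singleton_subset_iff] at hA' hB' hC'
    simp [pathP]
    tauto
  · have h1 : ({f, g, y} : Finset ℕ) = {y, f, g} := by ext v; simp; tauto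
    rw [h1] at hCe
    simp [pathP, Finset.image_insert, ← hAe, ← hBe, ← hCe, hA, hB, hC]

def HasQ (H : ThreeGraph) : Prop := ∃ A ∈ H.edges, ∃ B ∈ H.edges, (A ∩ B).card = 1

def HasC (H : ThreeGraph) : Prop := ∃ A ∈ H.edges, ∃ B ∈ H.edges, ∃ C ∈ H.edges,
  (A ∩ B).card = 1 ∧ (B ∩ C).card = 1 ∧ (A ∩ C).card = 1 ∧ A ∩ (B ∩ C) = ∅

theorem famT_norm (k : ℕ) : ∃ k' < 6, famT k = famT k' := by
  match k with
  | 0 => exact ⟨0, by norm_num, rfl⟩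
  | 1 => exact ⟨1, by norm_num, rfl⟩
  | 2 => exact ⟨2, by norm_num, rfl⟩
  | 3 => exact ⟨3, by norm_num, rfl⟩
  | 4 => exact ⟨4, by norm_num, rfl⟩
  | n + 5 => exact ⟨5, by norm_num, rfl⟩

/-- The certified case analysis, transported to `H` along the labeling `L`. -/
theorem core (H : ThreeGraph) (hv : H.IsValid) (h13 : 13 ≤ H.edges.card) (L : List ℕ)
    (hL : L.Nodup) (hlen : L.length = 8) (hLV : L.toFinset = H.verts)
    (bad : ℕ → ℕ → ℕ → Bool) (t : CTree) (inn : List ℕ) (hchk : chk0 bad t inn = true)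
    (hbad : ∀ e f g, e < 256 → f < 256 → g < 256 →
      (bitsOf e).image (fun i => L.getD i 0) ∈ H.edges →
      (bitsOf f).image (fun i => L.getD i 0) ∈ H.edges →
      (bitsOf g).image (fun i => L.getD i 0) ∈ H.edges → bad e f g = true → False)
    (hin : ∀ m ∈ inn, m ∈ triplesM ∧ (bitsOf m).image (fun i => L.getD i 0) ∈ H.edges) :
    ∃ k < 6, GoodEmb (famG k) H := by
  set φ : ℕ → ℕ := fun i => L.getD i 0 with hφdef
  have hφ : Set.InjOn φ (↑(Finset.range 8) : Set ℕ) := hlen ▸ getD_injOn L hL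
  have hφV : (Finset.range 8).image φ = H.verts := by
    rw [← hLV, ← getD_image, hlen]
  have hsurj : ∀ e ∈ H.edges, ∃ m ∈ triplesM, (bitsOf m).image φ = e := by
    intro e he
    obtain ⟨h3, hsub⟩ := hv e he
    rw [← hφV] at hsub
    obtain ⟨T, hT, rfl⟩ := Finset.subset_image_iff.1 hsub
    have hT' : T ⊆ Finset.range 8 := by exact_mod_cast hT
    have hc : (T.image φ).card = T.card := Finset.card_image_of_injOn (hφ.mono (by exact_mod_cast hT))
    obtain ⟨m, hm, hmT⟩ := triplesM_surj T (Finset.mem_powersetCard.2 ⟨hT', by omega⟩)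
    exact ⟨m, hm, by rw [hmT]⟩
  obtain ⟨av, hav, hcase⟩ := chk0_sound bad
    (fun m => m ∈ triplesM ∧ (bitsOf m).image φ ∈ H.edges)
    (fun e f g he hf hg hb => hbad e f g (triplesM_lt e he.1) (triplesM_lt f hf.1)
      (triplesM_lt g hg.1) he.2 hf.2 hg.2 hb)
    (fun m hm => hm.1) t inn hchk hin
  rcases hcase with hlt | ⟨k, τ, hcov⟩
  · exfalso
    have hsub : H.edges ⊆ (av.map (fun m => (bitsOf m).image φ)).toFinset := by
      intro e he
      obtain ⟨m, hm, rfl⟩ := hsurj e he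
      rw [List.mem_toFinset]
      exact List.mem_map.2 ⟨m, hav m ⟨hm, he⟩, rfl⟩
    have h1 := Finset.card_le_card hsub
    have h2 := List.toFinset_card_le (av.map (fun m => (bitsOf m).image φ))
    rw [List.length_map] at h2
    omega
  · obtain ⟨k', hk', hkk⟩ := famT_norm k
    unfold covCheck at hcov
    rw [hkk] at hcov
    simp only [Bool.and_eq_true, decide_eq_true_eq] at hcov
    obtain ⟨⟨hτl, hτ8, hτn⟩, hall⟩ := hcov
    have hτl' : τ.length = 8 := Nat.eq_of_beq_eq_true hτl
    have hτlt : ∀ i < 8, τ.getD i 0 < 8 := by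
      intro i hi
      rw [List.getD_eq_getElem _ _ (by omega)]
      have := List.all_eq_true.1 hτ8 _ (List.getElem_mem (l := τ) (n := i) (by omega))
      simpa [Nat.blt] using this
    have hτi : Set.InjOn (fun i => τ.getD i 0) (↑(Finset.range 8) : Set ℕ) :=
      hτl' ▸ getD_injOn τ hτn
    have hψ : Set.InjOn (fun i => φ (τ.getD i 0)) (↑(Finset.range 8) : Set ℕ) := by
      intro i hi j hj h
      have hi' : i < 8 := by simpa using hi
      have hj' : j < 8 := by simpa using hj
      exact hτi hi hj (hφ (by simpa using hτlt i hi') (by simpa using hτlt j hj') h)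
    refine ⟨k', hk', fun i => φ (τ.getD i 0), hψ, ?_, ?_⟩
    · apply Finset.eq_of_subset_of_card_le
      · intro x hx
        obtain ⟨i, hi, rfl⟩ := Finset.mem_image.1 hx
        rw [← hφV]
        exact Finset.mem_image_of_mem _ (by simpa using hτlt i (by simpa using hi))
      · rw [Finset.card_image_of_injOn hψ, ← hφV, Finset.card_image_of_injOn hφ]
    · intro e he
      obtain ⟨m, hm, rfl⟩ := hsurj e he
      have hm' := List.all_eq_true.1 hall m (hav m ⟨hm, he⟩)
      obtain ⟨s, hs, hsm⟩ := List.any_eq_true.1 hm'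
      have hsm' := Nat.eq_of_beq_eq_true hsm
      obtain ⟨s1, s2, s3⟩ := famT_lt k' hk' s hs
      refine Finset.mem_image.2 ⟨_, famT_mem k' hk' s hs, ?_⟩
      rw [← hsm', bits_mask _ (hτlt _ s1) _ (hτlt _ s2) _ (hτlt _ s3)]
      simp [Finset.image_insert]

theorem bad_P (H : ThreeGraph) (hv : H.IsValid) (hP : H.Free pathP) (φ : ℕ → ℕ)
    (hφ : Set.InjOn φ (↑(Finset.range 8) : Set ℕ)) (e f g : ℕ) (he : e < 256) (hf : f < 256)
    (_hg : g < 256) (hE : (bitsOf e).image φ ∈ H.edges) (hF : (bitsOf f).image φ ∈ H.edges)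
    (hG : (bitsOf g).image φ ∈ H.edges) (hb : isPm e f g = true) : False := by
  have key : ∀ a b c, a < 256 → b < 256 → (bitsOf a).image φ ∈ H.edges →
      (bitsOf b).image φ ∈ H.edges → (bitsOf c).image φ ∈ H.edges → pth a b c = true → False := by
    intro a b c ha hb hA hB hC h
    simp only [pth, Bool.and_eq_true] at h
    exact hP (contains_path H hv _ _ _ hA hB hC (S_zero φ hφ a c h.1) (S_one φ hφ a b ha h.2.1)
      (S_one φ hφ b c hb h.2.2))
  simp only [isPm, Bool.or_eq_true] at hb
  rcases hb with h | h | h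
  · exact key _ _ _ he hf hE hF hG h
  · exact key _ _ _ hf he hF hE hG h
  · exact key _ _ _ he _hg hE hG hF h

theorem bad_C (H : ThreeGraph) (hC : ¬ HasC H) (φ : ℕ → ℕ)
    (hφ : Set.InjOn φ (↑(Finset.range 8) : Set ℕ)) (e f g : ℕ) (he : e < 256) (hf : f < 256)
    (hE : (bitsOf e).image φ ∈ H.edges) (hF : (bitsOf f).image φ ∈ H.edges)
    (hG : (bitsOf g).image φ ∈ H.edges) (hb : isCm e f g = true) : False := by
  simp only [isCm, Bool.and_eq_true] at hb
  refine hC ⟨_, hE, _, hF, _, hG, S_one φ hφ e f he hb.1, S_one φ hφ f g hf hb.2.1,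
    S_one φ hφ e g he hb.2.2.1, ?_⟩
  rw [S_inter φ hφ f g]
  exact S_zero φ hφ _ _ hb.2.2.2

theorem bits7 : bitsOf 7 = {0, 1, 2} := by decide +kernel
theorem bits28 : bitsOf 28 = {2, 3, 4} := by decide +kernel
theorem bits49 : bitsOf 49 = {0, 5, 4} := by decide +kernel
theorem mem_tr : 7 ∈ triplesM ∧ 28 ∈ triplesM ∧ 49 ∈ triplesM := by decide +kernel

theorem classify (H : ThreeGraph) (hv : H.IsValid) (hc : H.verts.card = 8) (hP : H.Free pathP)
    (h13 : 13 ≤ H.edges.card) : ∃ k < 6, GoodEmb (famG k) H := by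
  by_cases hC : HasC H
  · obtain ⟨A, hA, B, hB, C, hCC, hAB, hBC, hAC, hABC⟩ := hC
    obtain ⟨u, huA, huB, hu⟩ := one_mem hAB
    obtain ⟨v, hvB, hvC, hvv⟩ := one_mem hBC
    obtain ⟨w, hwA, hwC, hw⟩ := one_mem hAC
    have hd : ∀ x, x ∈ A → x ∈ B → x ∈ C → False := by
      intro x h1 h2 h3
      have : x ∈ A ∩ (B ∩ C) := Finset.mem_inter.2 ⟨h1, Finset.mem_inter.2 ⟨h2, h3⟩⟩
      rw [hABC] at this
      simp at this
    have huv : u ≠ v := fun h => hd u huA huB (h ▸ hvC)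
    have huw : w ≠ u := fun h => hd u huA huB (h ▸ hwC)
    have hvw : w ≠ v := fun h => hd v (h ▸ hwA) hvB hvC
    obtain ⟨a, ha1, ha2, hAe⟩ := card3 (hv A hA).1 hwA huA huw
    obtain ⟨b, hb1, hb2, hBe⟩ := card3 (hv B hB).1 huB hvB huv
    obtain ⟨c, hc1, hc2, hCe⟩ := card3 (hv C hCC).1 hwC hvC hvw
    have e1 : ∀ x, x ∈ A ↔ x = w ∨ x = a ∨ x = u := by intro x; rw [hAe]; simp
    have e2 : ∀ x, x ∈ B ↔ x = u ∨ x = b ∨ x = v := by intro x; rw [hBe]; simp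
    have e3 : ∀ x, x ∈ C ↔ x = w ∨ x = c ∨ x = v := by intro x; rw [hCe]; simp
    have hnd : [w, a, u, b, v, c].Nodup := by
      simp only [List.nodup_cons, List.mem_cons, List.not_mem_nil, or_false, not_or,
        List.nodup_nil, and_true, not_false_eq_true]
      clear hAe hBe hCe hABC hAC hAB hBC
      have m1 : a ∈ A := (e1 a).2 (by simp)
      have m2 : b ∈ B := (e2 b).2 (by simp)
      have m3 : c ∈ C := (e3 c).2 (by simp)
      clear e1 e2 e3
      grind
    obtain ⟨l', h1, h2, h3⟩ := extend_list H.verts _ hnd (by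
      intro x hx
      have : x ∈ A ∨ x ∈ B ∨ x ∈ C := by
        simp only [List.mem_cons, List.not_mem_nil, or_false] at hx
        rw [e1, e2, e3]
        tauto
      rcases this with h | h | h
      · exact (hv A hA).2 h
      · exact (hv B hB).2 h
      · exact (hv C hCC).2 h)
    rw [hc] at h2
    refine core H hv h13 _ h1 h2 h3 isPm treeC [7, 28, 49] chkC ?_ ?_
    · intro e f g he hf hg hE hF hG hb
      exact bad_P H hv hP _ (h2 ▸ getD_injOn _ h1) e f g he hf hg hE hF hG hb
    · intro m hm
      simp only [List.mem_cons, List.not_mem_nil, or_false] at hm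
      rcases hm with rfl | rfl | rfl
      · exact ⟨mem_tr.1, by rw [bits7]; simpa [Finset.image_insert, ← hAe] using hA⟩
      · exact ⟨mem_tr.2.1, by rw [bits28]; simpa [Finset.image_insert, ← hBe] using hB⟩
      · exact ⟨mem_tr.2.2, by rw [bits49]; simpa [Finset.image_insert, ← hCe] using hCC⟩
  · by_cases hQ : HasQ H
    · obtain ⟨A, hA, B, hB, hAB⟩ := hQ
      obtain ⟨u, huA, huB, hu⟩ := one_mem hAB
      obtain ⟨a, b, ha, hb, hab, hAe⟩ := card3' (hv A hA).1 huA
      obtain ⟨c, d, hc', hd, hcd, hBe⟩ := card3' (hv B hB).1 huB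
      have e1 : ∀ x, x ∈ A ↔ x = a ∨ x = b ∨ x = u := by intro x; rw [hAe]; simp
      have e2 : ∀ x, x ∈ B ↔ x = c ∨ x = d ∨ x = u := by intro x; rw [hBe]; simp
      have hnd : [a, b, u, c, d].Nodup := by
        simp only [List.nodup_cons, List.mem_cons, List.not_mem_nil, or_false, not_or,
          List.nodup_nil, and_true, not_false_eq_true]
        clear hAe hBe hAB
        have m1 : a ∈ A := (e1 a).2 (by simp)
        have m2 : b ∈ A := (e1 b).2 (by simp)
        have m3 : c ∈ B := (e2 c).2 (by simp)
        have m4 : d ∈ B := (e2 d).2 (by simp)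
        clear e1 e2
        grind
      obtain ⟨l', h1, h2, h3⟩ := extend_list H.verts _ hnd (by
        intro x hx
        have : x ∈ A ∨ x ∈ B := by
          simp only [List.mem_cons, List.not_mem_nil, or_false] at hx
          rw [e1, e2]
          tauto
        rcases this with h | h
        · exact (hv A hA).2 h
        · exact (hv B hB).2 h)
      rw [hc] at h2
      have h4 : ({c, d, u} : Finset ℕ) = {u, c, d} := by ext v; simp; tauto
      rw [h4] at hBe
      refine core H hv h13 _ h1 h2 h3 badQ treeQ [7, 28] chkQ ?_ ?_
      · intro e f g he hf hg hE hF hG hb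
        rw [badQ, Bool.or_eq_true] at hb
        rcases hb with hb | hb
        · exact bad_P H hv hP _ (h2 ▸ getD_injOn _ h1) e f g he hf hg hE hF hG hb
        · exact bad_C H hC _ (h2 ▸ getD_injOn _ h1) e f g he hf hE hF hG hb
      · intro m hm
        simp only [List.mem_cons, List.not_mem_nil, or_false] at hm
        rcases hm with rfl | rfl
        · exact ⟨mem_tr.1, by rw [bits7]; simpa [Finset.image_insert, ← hAe] using hA⟩
        · exact ⟨mem_tr.2.1, by rw [bits28]; simpa [Finset.image_insert, ← hBe] using hB⟩
    · obtain ⟨A, hA⟩ : H.edges.Nonempty := Finset.card_pos.1 (by omega)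
      obtain ⟨a, b, c, hab, hac, hbc, hAe⟩ := Finset.card_eq_three.1 (hv A hA).1
      have hnd : [a, b, c].Nodup := by simp [hab, hac, hbc]
      obtain ⟨l', h1, h2, h3⟩ := extend_list H.verts _ hnd (by
        intro x hx
        refine (hv A hA).2 ?_
        rw [hAe]
        simpa using hx)
      rw [hc] at h2
      refine core H hv h13 _ h1 h2 h3 badS treeS [7] chkS ?_ ?_
      · intro e f g he hf hg hE hF hG hb
        exact hQ ⟨_, hE, _, hF, S_one _ (h2 ▸ getD_injOn _ h1) e f he hb⟩
      · intro m hm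
        simp only [List.mem_cons, List.not_mem_nil, or_false] at hm
        subst hm
        exact ⟨mem_tr.1, by rw [bits7]; simpa [Finset.image_insert, ← hAe] using hA⟩

theorem goodEmb_contains (G H : ThreeGraph) (hG : G.verts = Finset.range 8) (hGe : ∀ e ∈ G.edges, e ⊆ G.verts)
    (h : GoodEmb G H) : G.ContainsCopy H := by
  obtain ⟨ψ, hi, hV, hE⟩ := h
  have hinv : ∀ i ∈ Finset.range 8, Function.invFunOn ψ (↑(Finset.range 8) : Set ℕ) (ψ i) = i :=
    fun i hi' => hi.leftInvOn_invFunOn (by exact_mod_cast hi')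
  refine ⟨Function.invFunOn ψ (↑(Finset.range 8) : Set ℕ), ?_, ?_, ?_⟩
  · intro x hx y hy h
    rw [← hV] at hx hy
    obtain ⟨i, hi1, rfl⟩ := Finset.mem_image.1 (Finset.mem_coe.1 hx)
    obtain ⟨j, hj1, rfl⟩ := Finset.mem_image.1 (Finset.mem_coe.1 hy)
    rw [hinv i hi1, hinv j hj1] at h
    rw [h]
  · intro v hv
    rw [← hV] at hv
    obtain ⟨i, hi1, rfl⟩ := Finset.mem_image.1 hv
    rw [hinv i hi1, hG]
    exact hi1
  · intro e he
    obtain ⟨s, hs, rfl⟩ := Finset.mem_image.1 (hE he)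
    have hs' := hGe s hs
    rw [hG] at hs'
    have : (s.image ψ).image (Function.invFunOn ψ (↑(Finset.range 8) : Set ℕ)) = s := by
      rw [Finset.image_image]
      conv_rhs => rw [← Finset.image_id (s := s)]
      exact Finset.image_congr (fun i hi1 => hinv i (hs' hi1))
    rw [this]
    exact hs

theorem famG_sub : ∀ k < 6, ∀ e ∈ (famG k).edges, e ⊆ (famG k).verts := by decide +kernel

theorem famG_mem_L8 : ∀ k < 5, famG k ∈ L8 := by
  intro k hk
  interval_cases k <;> simp [famG, L8]

/-- The dichotomy behind the theorem. -/
theorem dichotomy (H : ThreeGraph) (hv : H.IsValid) (hc : H.verts.card = 8) (hP : H.Free pathP)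
    (hn : ∀ G ∈ L8, ¬ G.ContainsCopy H) (h13 : 13 ≤ H.edges.card) :
    GoodEmb (K5plus 3) H := by
  obtain ⟨k, hk, hg⟩ := classify H hv hc hP h13
  by_cases h5 : k < 5
  · exact (hn _ (famG_mem_L8 k h5)
      (goodEmb_contains _ H (famG_verts k hk) (famG_sub k hk) hg)).elim
  · obtain rfl : k = 5 := by omega
    exact hg

/-! ### The extremal graph -/

theorem K5_free : (K5plus 3).Free pathP := by
  rintro ⟨f, hi, -, hE⟩
  have h1 : ({0, 1, 2} : Finset ℕ).image f ∈ (K5plus 3).edges := hE _ (by simp [pathP])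
  have h2 : ({2, 3, 4} : Finset ℕ).image f ∈ (K5plus 3).edges := hE _ (by simp [pathP])
  have h3 : ({4, 5, 6} : Finset ℕ).image f ∈ (K5plus 3).edges := hE _ (by simp [pathP])
  have hint : ∀ A B : Finset ℕ, A ⊆ pathP.verts → B ⊆ pathP.verts →
      A.image f ∩ B.image f = (A ∩ B).image f := by
    intro A B hA hB
    rw [Finset.image_inter_of_injOn]
    refine hi.mono ?_
    rintro x (hx | hx)
    · exact hA hx
    · exact hB hx
  refine K5_noP _ h1 _ h2 _ h3 ?_ ?_ ?_
  · rw [hint _ _ (by decide) (by decide), show ({0, 1, 2} : Finset ℕ) ∩ {4, 5, 6} = ∅ by decide]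
    rfl
  · rw [hint _ _ (by decide) (by decide), show ({0, 1, 2} : Finset ℕ) ∩ {2, 3, 4} = {2} by decide]
    rfl
  · rw [hint _ _ (by decide) (by decide), show ({2, 3, 4} : Finset ℕ) ∩ {4, 5, 6} = {4} by decide]
    rfl

theorem K5_mem : ∀ a ∈ Finset.range 5, ∀ b ∈ Finset.range 5, ∀ c ∈ Finset.range 5, a < b ∧ b < c →
    ({a, b, c} : Finset ℕ) ∈ (K5plus 3).edges := by decide +kernel

theorem not_contains_of_noK5 (G : ThreeGraph) (hG : G.verts = Finset.range 8)
    (h : NoK5 G.edges) : ¬ G.ContainsCopy (K5plus 3) := by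
  rintro ⟨f, -, hV, hE⟩
  have hlt : ∀ i < 5, f i < 8 := by
    intro i hi
    have := hV i (by simp [K5plus]; omega)
    rw [hG] at this
    simpa using this
  have hm : ∀ a < 5, ∀ b < 5, ∀ c < 5, a < b → b < c →
      ({f a, f b, f c} : Finset ℕ) ∈ G.edges := by
    intro a ha b hb c hc hab hbc
    have := hE _ (K5_mem a (by simpa using ha) b (by simpa using hb) c (by simpa using hc) ⟨hab, hbc⟩)
    simpa [Finset.image_insert] using this
  have hlt' : ∀ i < 5, f i ∈ Finset.range 8 := fun i hi => Finset.mem_range.2 (hlt i hi)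
  refine h (f 0) (hlt' 0 ?_) (f 1) (hlt' 1 ?_) (f 2) (hlt' 2 ?_) (hm 0 ?_ 1 ?_ 2 ?_ ?_ ?_)
    (f 3) (hlt' 3 ?_) (hm 0 ?_ 1 ?_ 3 ?_ ?_ ?_) (hm 0 ?_ 2 ?_ 3 ?_ ?_ ?_) (hm 1 ?_ 2 ?_ 3 ?_ ?_ ?_)
    (f 4) (hlt' 4 ?_) (hm 0 ?_ 1 ?_ 4 ?_ ?_ ?_) (hm 0 ?_ 2 ?_ 4 ?_ ?_ ?_) (hm 1 ?_ 2 ?_ 4 ?_ ?_ ?_)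
    (hm 0 ?_ 3 ?_ 4 ?_ ?_ ?_) (hm 1 ?_ 3 ?_ 4 ?_ ?_ ?_) (hm 2 ?_ 3 ?_ 4 ?_ ?_ ?_) <;> norm_num

theorem K5_cover : ∀ i ∈ (K5plus 3).verts, ∃ e ∈ (K5plus 3).edges, i ∈ e := by decide +kernel

theorem not_contains_K6 : ¬ ((KK 6).dUnion (KK 2)).ContainsCopy (K5plus 3) := by
  rintro ⟨f, hi, -, hE⟩
  have hsub : (K5plus 3).verts.image f ⊆ Finset.range 6 := by
    intro x hx
    obtain ⟨i, hi', rfl⟩ := Finset.mem_image.1 hx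
    obtain ⟨e, he, hie⟩ := K5_cover i hi'
    exact K6_edges _ (hE e he) (Finset.mem_image_of_mem f hie)
  have h := Finset.card_le_card hsub
  rw [Finset.card_image_of_injOn hi] at h
  simp [K5plus] at h

theorem K5_not_L8 : ∀ G ∈ L8, ¬ G.ContainsCopy (K5plus 3) := by
  intro G hG
  simp only [L8, List.mem_cons, List.not_mem_nil, or_false] at hG
  rcases hG with rfl | rfl | rfl | rfl | rfl
  · exact not_contains_of_noK5 _ rfl noK5_0
  · exact not_contains_K6
  · exact not_contains_of_noK5 _ rfl noK5_2
  · exact not_contains_of_noK5 _ rfl noK5_3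
  · exact not_contains_of_noK5 _ rfl noK5_4

theorem iso_card (H : ThreeGraph) (h : ThreeGraph.IsoCopy (K5plus 3) H) : H.edges.card = 13 := by
  obtain ⟨f, hi, -, hE⟩ := h
  rw [← hE, Finset.card_image_of_injOn, K5_card]
  intro A hA B hB hAB
  have hA' := (K5_valid A hA).2
  have hB' := (K5_valid B hB).2
  have key : ∀ X Y : Finset ℕ, X ⊆ (K5plus 3).verts → Y ⊆ (K5plus 3).verts →
      X.image f = Y.image f → X ⊆ Y := by
    intro X Y hX hY h x hx
    have : f x ∈ Y.image f := h ▸ Finset.mem_image_of_mem f hx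
    obtain ⟨y, hy, hyx⟩ := Finset.mem_image.1 this
    rw [← hi (hY hy) (hX hx) hyx]
    exact hy
  exact Finset.Subset.antisymm (key A B hA' hB' hAB) (key B A hB' hA' hAB.symm)

/-- The maximum number of edges of a `P`-free 3-graph on 8 vertices not contained
in any member of `L₈` equals 13, attained exactly by `K_5^{+3}`. -/
theorem fifth_order_turan_eight :
    IsGreatest {m : ℕ | ∃ H : ThreeGraph, H.IsValid ∧ H.verts.card = 8 ∧
      H.Free pathP ∧ (∀ G ∈ L8, ¬ G.ContainsCopy H) ∧ H.edges.card = m} 13 ∧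
    ∀ H : ThreeGraph, H.IsValid → H.verts.card = 8 → H.Free pathP →
      (∀ G ∈ L8, ¬ G.ContainsCopy H) →
      (H.edges.card = 13 ↔ ThreeGraph.IsoCopy (K5plus 3) H) := by
  have hle : ∀ H : ThreeGraph, H.IsValid → H.verts.card = 8 → H.Free pathP →
      (∀ G ∈ L8, ¬ G.ContainsCopy H) → 13 ≤ H.edges.card →
      H.edges.card ≤ 13 ∧ ThreeGraph.IsoCopy (K5plus 3) H := by
    intro H hv hc hP hn h13
    obtain ⟨ψ, hi, hV, hE⟩ := dichotomy H hv hc hP hn h13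
    have h1 := Finset.card_le_card hE
    have h2 : ((K5plus 3).edges.image (Finset.image ψ)).card ≤ (K5plus 3).edges.card :=
      Finset.card_image_le
    rw [K5_card] at h2
    exact ⟨by omega, ψ, hi, hV, (Finset.eq_of_subset_of_card_le hE (by omega)).symm⟩
  refine ⟨⟨⟨K5plus 3, K5_valid, by simp [K5plus], K5_free, K5_not_L8, K5_card⟩, ?_⟩, ?_⟩
  · rintro m ⟨H, hv, hc, hP, hn, rfl⟩
    by_contra hlt
    have := (hle H hv hc hP hn (by omega)).1
    omega
  · intro H hv hc hP hn
    exact ⟨fun h => (hle H hv hc hP hn (by omega)).2, iso_card H⟩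
end

section
/- Let L_9 = {S_9, K_6 ∪ K_3, G_1(9), G_2(9), G_3(9)}. The maximum number of edges of a P-free 3-graph H on 9 vertices such that H is not contained in any member of L_9 equals 14. -/
/-- The family `L₉`. -/
def L9 : List ThreeGraph := [SS 9, (KK 6).dUnion (KK 3), G1 9, G2 9, G3 9]

namespace Turan9

/-- Certificate trees for the branching search. -/
inductive CT : Type
  | z : CT
  | c (k v0 v1 v2 v3 v4 : ℕ) : CT
  | b (e : ℕ) (s t : CT) : CT

/-- `x` is nonzero with at most one bit. -/
def one (x : ℕ) : Bool := !(Nat.beq x 0) && Nat.beq (Nat.land x (Nat.sub x 1)) 0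

def zer (x : ℕ) : Bool := Nat.beq x 0

/-- the three edges form a loose path -/
def isP (e f g : ℕ) : Bool :=
  bif zer (Nat.land e f) then one (Nat.land e g) && one (Nat.land f g)
  else bif one (Nat.land e f) then
    (zer (Nat.land e g) && one (Nat.land f g)) || (zer (Nat.land f g) && one (Nat.land e g))
  else false

/-- the three edges form a loose triangle -/
def isC (e f g : ℕ) : Bool :=
  one (Nat.land e f) && (one (Nat.land e g) && (one (Nat.land f g)
    && zer (Nat.land (Nat.land e f) g)))

def badPC (e f g : ℕ) : Bool := isP e f g || isC e f g
def noPair (_ _ : ℕ) : Bool := false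
def disjPair (e f : ℕ) : Bool := zer (Nat.land e f)
def smallPair (e f : ℕ) : Bool := zer (Nat.land e f) || one (Nat.land e f)

/-- Membership test for the five extremal graphs, in terms of which of the
five distinguished vertices `0,…,4` lie in a triple. -/
def tst (k : ℕ) (a b c d e : Bool) : Bool :=
  match k with
  | 0 => a
  | 1 => (a && b && c) || (!a && !b && !c)
  | 2 => (a && b && c) || (d && (a || b || c))
  | 3 => (a && b) || (a && c) || (b && c)
  | 4 => (a && (d || e)) || (a && b && c) || (d && e && (b || c))
  | _ => false

def okv (v0 v1 v2 v3 v4 : ℕ) : Bool :=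
  decide ([v0, v1, v2, v3, v4].Nodup ∧ ∀ x ∈ [v0, v1, v2, v3, v4], x < 9)

def tstm (k v0 v1 v2 v3 v4 m : ℕ) : Bool :=
  tst k (m.testBit v0) (m.testBit v1) (m.testBit v2) (m.testBit v3) (m.testBit v4)

def step (bad : ℕ → ℕ → ℕ → Bool) (bad2 : ℕ → ℕ → Bool) (e : ℕ) (I C : List ℕ) : List ℕ :=
  C.filter (fun g => !(Nat.beq g e) && (!(bad2 e g) && I.all (fun f => !(bad e f g))))

def check (bad : ℕ → ℕ → ℕ → Bool) (bad2 : ℕ → ℕ → Bool) : CT → List ℕ → List ℕ → Bool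
  | .z, I, C => Nat.ble (I.length + C.length) 14
  | .c k v0 v1 v2 v3 v4, I, C => okv v0 v1 v2 v3 v4 &&
      (I.all (tstm k v0 v1 v2 v3 v4) && C.all (tstm k v0 v1 v2 v3 v4))
  | .b e s t, I, C => check bad bad2 s (e :: I) (step bad bad2 e I C) &&
      check bad bad2 t I (C.filter (fun g => !(Nat.beq g e)))

def start (bad : ℕ → ℕ → ℕ → Bool) (bad2 : ℕ → ℕ → Bool) (t : CT) :
    List ℕ → List ℕ → List ℕ → Bool
  | [], I, C => check bad bad2 t I C
  | e :: l, I, C => start bad bad2 t l (e :: I) (step bad bad2 e I C)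

/-- the bitmasks of the 84 triples -/
def tri : List ℕ := (List.range 512).filter
  (fun m => Nat.beq ((List.range 9).countP (fun i => m.testBit i)) 3)

section trees
open CT
def t1 : CT := (b 448 (c 1 6 7 8 0 1) (b 14 (b 81 z (b 145 z (b 273 z (c 1 6 7 8 0 1)))) (b 35 (b 84 z (b 148 z
  (b 276 z (c 1 6 7 8 0 1)))) (b 56 (b 69 z (b 133 z (b 261 z (c 1 6 7 8 0 1)))) (b 73 (b 42 (b
  82 z (b 100 z (b 19 z z))) (b 82 (b 100 z (b 11 z z)) (b 100 (b 41 z z) (b 26 (b 44 z (b 84 z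
  (c 4 0 1 2 3 4))) (b 44 (b 84 z (c 4 0 4 5 2 3)) (b 84 (c 4 0 3 6 2 4) (c 2 2 3 4 0 1)))))))
  (b 82 (b 42 (b 100 z (b 11 z z)) (b 100 (b 38 z z) (b 11 (b 38 z (b 69 z (c 4 4 2 3 0 1))) (b
  38 (b 69 z (c 4 4 0 5 1 2)) (b 69 (c 4 4 1 6 0 2) (c 2 0 1 2 4 3)))))) (b 100 (b 42 (b 13 z z)
  (b 41 (b 50 z (b 81 z (c 4 2 3 4 0 5))) (b 50 (b 81 z (c 4 2 0 1 4 5)) (b 81 (c 4 2 5 6 0 4)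
  (c 2 0 4 5 2 1))))) (b 42 (b 137 (b 146 z (b 164 z z)) (b 146 (b 164 z z) (b 164 z (b 265 (b
  274 z z) (b 274 z (b 292 z (c 1 6 7 8 0 1))))))) (b 137 (b 146 (b 164 z (b 11 z z)) (b 164 (b
  41 z z) (b 26 (b 44 z (b 148 z (c 4 0 1 2 3 4))) (b 44 (b 148 z (c 4 0 4 5 2 3)) (b 148 (c 4 0
  3 7 2 4) (c 2 2 3 4 0 1)))))) (b 146 (b 164 (b 38 z z) (b 11 (b 38 z (b 133 z (c 4 4 2 3 0
  1))) (b 38 (b 133 z (c 4 4 0 5 1 2)) (b 133 (c 4 4 1 7 0 2) (c 2 0 1 2 4 3))))) (b 164 (b 41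
  (b 50 z (b 145 z (c 4 2 3 4 0 5))) (b 50 (b 145 z (c 4 2 0 1 4 5)) (b 145 (c 4 2 5 7 0 4) (c 2
  0 4 5 2 1)))) (b 265 (b 274 (b 292 z (b 11 z z)) (b 292 (b 41 z z) (b 26 (b 44 z (b 276 z z))
  (b 44 (b 276 z z) (b 276 (c 4 0 3 8 2 4) (c 2 2 3 4 0 1)))))) (b 274 (b 292 (b 38 z z) (b 11
  (b 38 z (b 261 z z)) (b 38 (b 261 z z) (b 261 (c 4 4 1 8 0 2) (c 2 0 1 2 4 3))))) (b 292 (b 41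
  (b 50 z (b 273 z z)) (b 50 (b 273 z z) (b 273 (c 4 2 5 8 0 4) (c 2 0 4 5 2 1)))) (b 11 (b 52
  (c 1 6 7 8 0 1) (b 26 (b 37 (c 1 6 7 8 0 1) (b 38 z (b 44 z (b 13 (b 50 z z) z)))) (b 38 (b 25
  z (b 50 z (b 13 (b 19 (b 44 z z) z) z))) (b 44 (b 19 z (b 50 z z)) (b 50 (b 13 z z) (b 13 (b
  19 (b 21 (b 22 (b 41 z (c 4 0 1 3 2 4)) (c 2 2 3 4 0 1)) (b 22 (b 41 z (c 4 0 1 3 2 4)) (c 2 2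
  3 4 0 1))) (b 21 (b 22 (b 41 z (c 4 0 1 3 2 4)) (c 2 2 3 4 0 1)) (b 22 (b 41 z z) z))) (b 19
  (b 21 (b 22 (b 41 z (c 4 0 1 3 2 4)) (c 2 2 3 4 0 1)) (b 22 (b 41 z z) z)) (b 21 (b 22 (b 41 z
  z) z) z)))))))) (b 26 (b 37 (c 1 6 7 8 0 1) (b 38 (b 25 z (b 41 z (b 13 (b 50 z z) z))) (b 41
  (b 22 z (b 44 z z)) (b 44 (b 19 z z) (b 13 (b 50 z (c 4 4 1 3 0 2)) (c 2 0 1 2 4 3)))))) (b 38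
  (b 25 z (b 41 (b 22 z (b 50 z z)) (b 50 (b 13 z z) (b 13 (b 19 (b 44 z (c 4 2 1 5 0 4)) (c 2 0
  4 5 2 1)) (b 19 (b 44 z (c 4 2 1 5 0 4)) (c 2 0 4 5 2 1)))))) (b 41 (b 22 z (b 44 (b 19 z z)
  (b 50 z (c 4 0 3 5 2 4)))) (b 44 (b 19 z (b 50 z (c 4 2 3 5 0 4))) (b 50 (b 13 z (c 4 4 1 5 0
  2)) (c 3 0 2 4 1 3)))))))))))))))))))))

def t2 : CT := (b 193 (b 14 (b 49 z (b 200 z (b 280 z z))) (b 22 (b 41 z (b 208 z z)) (b 38 (b 25 z z) (b 200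
  (b 49 z (b 259 z z)) (b 208 (b 41 z z) (b 224 z (b 25 (b 262 z (b 280 z (b 448 z z))) (b 41 (b
  262 z (b 448 z z)) (b 49 (b 262 z z) (b 259 (c 1 3 4 5 0 1) (b 261 z (b 321 z (b 385 z (b 67
  (b 262 z (b 448 z z)) (b 69 (b 262 z z) z))))))))))))))) (b 194 (b 200 (b 13 z (b 50 z z)) (b
  208 (b 21 z z) (b 224 z (b 13 (b 50 z (b 280 z z)) (b 21 (b 42 z z) (b 37 z (b 280 (b 448 z (b
  26 z z)) (b 296 (b 448 z z) (b 304 z (b 69 z (b 133 z (b 196 z (b 26 (b 261 z (b 448 z z)) (b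
  42 (b 261 z z) z)))))))))))))) (b 196 (b 200 (b 11 z z) (b 208 z (b 224 z (b 11 (b 52 z (b 280
  z z)) (b 19 (b 44 z z) (b 35 z (b 280 (b 448 z z) (b 296 z (b 304 z (b 67 z (b 131 z (b 28 (b
  259 z (b 448 z z)) (b 44 (b 259 z z) z))))))))))))) (b 200 (b 49 (b 14 z (b 259 z z)) (b 50 (b
  13 z z) (b 52 z (b 11 (b 259 z (b 304 z (b 448 z z))) (b 13 (b 304 z (b 448 z z)) (b 14 (b 304
  z z) (b 280 (c 1 0 1 2 3 4) (b 296 z (b 328 z (b 392 z (b 88 (b 304 z (b 448 z z)) (b 104 (b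
  304 z z) z)))))))))))) (b 208 (b 41 (b 22 z (b 259 z z)) (b 42 (b 21 z z) (b 44 z (b 259 (b
  448 z (b 19 z z)) (b 261 (b 448 z z) (b 262 z (b 104 z (b 168 z (b 224 z (b 19 (b 296 z (b 448
  z z)) (b 21 (b 296 z z) z))))))))))) (b 224 (b 25 (b 38 z (b 259 z z)) (b 26 (b 37 z z) (b 28
  z (b 259 (b 448 z z) (b 261 z (b 262 z (b 88 z (b 152 z (b 35 (b 280 z (b 448 z z)) (b 37 (b
  280 z z) z)))))))))) (b 321 (b 14 (b 49 z (b 328 z z)) (b 22 (b 41 z z) (b 38 z (b 328 (b 49 z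
  (b 131 z z)) (b 336 (b 41 z z) (b 352 z (b 25 (b 448 z (b 134 z z)) (b 41 (b 448 z z) (b 49 z
  (b 131 z (b 133 z (b 385 z (b 67 (b 134 z (b 448 z z)) (b 69 (b 134 z z) z)))))))))))))) (b
  322 (b 13 (b 50 z (b 328 z z)) (b 21 (b 42 z z) (b 37 z (b 328 (b 50 z z) (b 336 z (b 352 z (b
  26 (b 448 z (b 133 z z)) (b 42 (b 448 z z) (b 50 z (b 131 z (b 134 z (b 386 z (b 67 (b 133 z
  z) z))))))))))))) (b 324 (b 328 (b 11 z z) (b 336 z (b 352 z (b 11 (b 52 z z) (b 19 z (b 35 z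
  (b 67 (b 448 z z) (b 152 z (b 168 z (b 176 z (b 259 z (b 28 (b 448 z z) z)))))))))))) (b 328
  (b 49 (b 14 z z) (b 50 z (b 52 z (b 11 (b 448 z (b 131 z z)) (b 13 (b 448 z z) (b 14 z (b 152
  z (b 168 z (b 392 z (b 88 (b 176 z (b 448 z z)) (b 104 (b 176 z z) z))))))))))) (b 336 (b 41
  (b 22 z z) (b 42 z (b 44 z (b 19 (b 448 z (b 131 z z)) (b 21 (b 448 z z) (b 22 z (b 152 z (b
  176 z (b 400 z (b 88 (b 168 z z) z)))))))))) (b 352 (b 25 (b 38 z z) (b 26 z (b 28 z (b 88 (b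
  448 z z) (b 131 z (b 133 z (b 134 z (b 280 z (b 35 (b 448 z z) z))))))))) (b 385 (b 14 (b 49 z
  z) (b 22 z (b 38 z (b 25 (b 416 z (b 448 z z)) (b 41 (b 448 z z) (b 49 z (b 392 (b 67 z z) (b
  400 z (b 416 z (b 67 z (b 69 z (b 70 (b 88 z (b 104 z z)) (b 88 (b 448 z z) z))))))))))))) (b
  386 (b 13 (b 50 z z) (b 21 z (b 37 z (b 133 (b 448 z z) (b 261 z (b 392 (b 50 z z) (b 400 z (b
  416 z (b 88 z (b 104 z (b 112 z (b 388 z z)))))))))))) (b 388 (b 11 (b 52 z z) (b 19 z (b 35 z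
  (b 131 z (b 259 z (b 392 z (b 400 z (b 416 z (b 88 z (b 104 z (b 112 z z))))))))))) (b 392 (b
  49 z (b 50 z (b 52 z (b 11 (b 448 z z) (b 13 z (b 14 z (b 88 z (b 104 z (b 67 (b 112 z (b 448
  z z)) (b 69 (b 112 z z) z)))))))))) (b 400 (b 41 z (b 42 z (b 44 z (b 19 (b 448 z z) (b 21 z
  (b 22 z (b 88 z (b 112 z (b 67 (b 448 z z) z))))))))) (b 416 (b 25 z (b 26 z (b 28 z (b 104 z
  (b 112 z (b 35 z (b 37 z (b 38 z z)))))))) (b 11 (b 25 (b 448 z (b 13 z (b 14 z (b 41 z (b 49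
  z z))))) (b 26 (b 448 z (b 13 z (b 14 z (b 42 z z)))) (b 28 (b 13 z (b 14 z (b 44 z z))) (b 88
  (b 13 z (b 14 z (b 168 z z))) (b 152 (b 13 z (b 14 z z)) (b 280 (b 13 z z) (b 104 (b 13 z (b
  14 z (b 112 z z))) (b 168 (b 13 z (b 14 z z)) (b 296 (b 13 z z) (b 13 (b 41 z z) (b 14 z (b 41
  z (b 42 z (b 44 z (b 19 (b 448 z z) z))))))))))))))) (b 13 (b 25 (b 448 z (b 14 z (b 41 z (b
  49 z z)))) (b 26 (b 14 z (b 42 z (b 50 z z))) (b 28 (b 448 z (b 14 z z)) (b 88 (b 14 z (b 168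
  z z)) (b 152 (b 14 z z) (b 280 z (b 104 (b 14 z (b 112 z z)) (b 168 (b 14 z z) (b 296 z (b 14
  z (b 41 z (b 42 z (b 44 z (b 21 (b 448 z z) z)))))))))))))) (b 14 (b 25 (b 41 z (b 49 z (b 448
  z z))) (b 26 (b 448 z (b 42 z z)) (b 28 (b 448 z z) (b 88 (b 168 z z) (b 152 z (b 280 z (b 104
  (b 112 z z) (b 168 z (b 296 z (b 41 z (b 42 z (b 44 z (b 22 (b 448 z z) z))))))))))))) (b 25
  (b 19 (b 448 z (b 41 z (b 49 z (b 21 z z)))) (b 21 (b 448 z (b 41 z (b 49 z z))) (b 22 (b 41 z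
  (b 49 z z)) (b 35 (b 41 z (b 49 z (b 37 z z))) (b 37 (b 41 z (b 49 z z)) (b 38 (b 41 z z) (b
  448 z (b 41 z (b 49 z (b 70 z (b 134 z (b 262 z z)))))))))))) (b 26 (b 19 (b 448 z (b 21 z (b
  22 z z))) (b 21 (b 22 z (b 42 z z)) (b 22 (b 448 z z) (b 35 (b 42 z (b 50 z z)) (b 37 (b 42 z
  z) (b 38 z (b 448 z (b 42 z (b 50 z (b 69 z (b 133 z z))))))))))) (b 28 (b 19 (b 21 z (b 22 z
  z)) (b 21 (b 448 z z) (b 22 z (b 35 (b 37 z z) (b 37 z (b 38 z (b 448 z (b 67 z (b 131 z (b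
  259 z z)))))))))) (b 19 (b 88 (b 21 z (b 22 z z)) (b 152 (b 21 z z) (b 280 z (b 112 (b 104 z
  (b 21 z z)) (b 176 (b 21 z z) (b 304 z (b 49 z (b 50 z (b 52 z (b 21 z (b 22 z z))))))))))) (b
  21 (b 88 (b 22 z z) (b 152 z (b 280 z (b 112 (b 104 z z) (b 176 z (b 304 z (b 49 z (b 50 z (b
  52 z (b 22 z z)))))))))) (b 22 (b 88 z (b 152 z (b 280 z (b 112 z (b 176 z (b 304 z (b 49 z (b
  50 z (b 52 z z))))))))) (b 41 (b 35 (b 448 z (b 49 z z)) (b 37 (b 448 z z) (b 38 z (b 448 z (b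
  49 z (b 70 z (b 134 z (b 262 z z)))))))) (b 42 (b 35 (b 448 z z) (b 37 z (b 38 z (b 448 z (b
  50 z (b 69 z (b 133 z z))))))) (b 44 (b 35 z (b 37 z (b 38 z (b 448 z (b 67 z (b 131 z z))))))
  (b 35 (b 88 z (b 152 z (b 280 z (b 448 z (b 37 z (b 38 z (b 49 z z))))))) (b 37 (b 88 z (b 152
  z (b 280 z (b 448 z (b 38 z (b 49 z z)))))) (b 38 (b 88 z (b 152 z (b 280 z (b 448 z (b 49 z
  z))))) (b 49 (b 448 z (b 70 z (b 134 z (b 262 z z)))) (b 50 (b 448 z (b 69 z (b 133 z z))) (b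
  52 (b 448 z (b 67 z z)) (b 67 (b 448 z (b 88 z (b 104 z (b 112 z (b 133 z (b 134 z (b 261 z
  z))))))) (b 69 (b 448 z (b 88 z (b 104 z (b 112 z (b 131 z (b 134 z z)))))) (b 70 (b 448 z (b
  88 z (b 104 z (b 112 z (b 131 z z))))) (b 88 (b 448 z (b 168 z (b 176 z (b 296 z z)))) (b 104
  (b 448 z (b 152 z (b 176 z z))) (b 112 (b 448 z (b 152 z z)) (b 131 (b 261 z z)
  z)))))))))))))))))))))))))))))))))))))))))))

def t3 : CT := (b 11 z (b 19 z (b 25 z (b 26 z (c 0 2 0 1 3 4)))))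

def t4 : CT := (c 3 0 1 2 3 4)
end trees

set_option maxRecDepth 100000 in
theorem run1 : start isP noPair t1 [7, 28, 49] [] tri = true := by decide +kernel
set_option maxRecDepth 100000 in
theorem run2 : start badPC noPair t2 [7, 56] [] tri = true := by decide +kernel
set_option maxRecDepth 100000 in
theorem run3 : start badPC disjPair t3 [7, 28] [] tri = true := by decide +kernel
set_option maxRecDepth 100000 in
theorem run4 : start badPC smallPair t4 [7] [] tri = true := by decide +kernel

end Turan9

namespace Turan9
open Finset

theorem beq_ne {x y : ℕ} (h : x ≠ y) : Nat.beq x y = false := by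
  rw [← Bool.not_eq_true]
  exact fun h' => h (Nat.eq_of_beq_eq_true h')

theorem check_sound {bad : ℕ → ℕ → ℕ → Bool} {bad2 : ℕ → ℕ → Bool} {S : Finset ℕ}
    (hb : ∀ a ∈ S, ∀ b ∈ S, ∀ c ∈ S, bad a b c = false)
    (hb2 : ∀ a ∈ S, ∀ b ∈ S, bad2 a b = false) (hc : 15 ≤ S.card) :
    ∀ (t : CT) (I C : List ℕ), check bad bad2 t I C = true → (∀ x ∈ I, x ∈ S) →
      (∀ x ∈ S, x ∈ I ∨ x ∈ C) →
      ∃ k v0 v1 v2 v3 v4, okv v0 v1 v2 v3 v4 = true ∧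
        ∀ m ∈ S, tstm k v0 v1 v2 v3 v4 m = true := by
  intro t
  induction t with
  | z =>
    intro I C h hI hS
    exfalso
    have h1 : I.length + C.length ≤ 14 := Nat.le_of_ble_eq_true h
    have h2 : S ⊆ (I ++ C).toFinset := by
      intro x hx
      simpa using hS x hx
    have h3 := Finset.card_le_card h2
    have h4 := (I ++ C).toFinset_card_le
    rw [List.length_append] at h4
    omega
  | c k v0 v1 v2 v3 v4 =>
    intro I C h hI hS
    simp only [check, Bool.and_eq_true, List.all_eq_true] at h
    refine ⟨k, v0, v1, v2, v3, v4, h.1, fun m hm => ?_⟩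
    rcases hS m hm with h' | h'
    · exact h.2.1 m h'
    · exact h.2.2 m h'
  | b e s t ihs iht =>
    intro I C h hI hS
    simp only [check, Bool.and_eq_true] at h
    by_cases he : e ∈ S
    · refine ihs _ _ h.1 ?_ ?_
      · intro x hx
        rcases List.mem_cons.1 hx with rfl | hx
        · exact he
        · exact hI x hx
      · intro x hx
        by_cases hxe : x = e
        · simp [hxe]
        · rcases hS x hx with h' | h'
          · simp [h']
          · right
            simp only [step, List.mem_filter, Bool.and_eq_true, List.all_eq_true]
            refine ⟨h', by rw [beq_ne hxe]; rfl, by simp [hb2 e he x hx], fun f hf => ?_⟩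
            simp [hb e he f (hI f hf) x hx]
    · refine iht _ _ h.2 hI ?_
      intro x hx
      rcases hS x hx with h' | h'
      · exact Or.inl h'
      · right
        simp only [List.mem_filter]
        refine ⟨h', ?_⟩
        have : x ≠ e := fun h => he (h ▸ hx)
        rw [beq_ne this]
        rfl

theorem start_sound {bad : ℕ → ℕ → ℕ → Bool} {bad2 : ℕ → ℕ → Bool} {S : Finset ℕ}
    (hb : ∀ a ∈ S, ∀ b ∈ S, ∀ c ∈ S, bad a b c = false)
    (hb2 : ∀ a ∈ S, ∀ b ∈ S, bad2 a b = false) (hc : 15 ≤ S.card) (t : CT) :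
    ∀ (l I C : List ℕ), start bad bad2 t l I C = true → (∀ x ∈ l, x ∈ S) → (∀ x ∈ I, x ∈ S) →
      (∀ x ∈ S, x ∈ I ∨ x ∈ C) →
      ∃ k v0 v1 v2 v3 v4, okv v0 v1 v2 v3 v4 = true ∧
        ∀ m ∈ S, tstm k v0 v1 v2 v3 v4 m = true := by
  intro l
  induction l with
  | nil =>
    intro I C h _ hI hS
    exact check_sound hb hb2 hc t I C h hI hS
  | cons e l ih =>
    intro I C h hl hI hS
    have he : e ∈ S := hl e (by simp)
    refine ih _ _ h (fun x hx => hl x (by simp [hx])) ?_ ?_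
    · intro x hx
      rcases List.mem_cons.1 hx with rfl | hx
      · exact he
      · exact hI x hx
    · intro x hx
      by_cases hxe : x = e
      · simp [hxe]
      · rcases hS x hx with h' | h'
        · simp [h']
        · right
          simp only [step, List.mem_filter, Bool.and_eq_true, List.all_eq_true]
          refine ⟨h', by rw [beq_ne hxe]; rfl, by simp [hb2 e he x hx], fun f hf => ?_⟩
          simp [hb e he f (hI f hf) x hx]

/-- decoding of a bitmask -/
def D (m : ℕ) : Finset ℕ := (range 9).filter (fun i => m.testBit i = true)

theorem D_land (a b : ℕ) : D (Nat.land a b) = D a ∩ D b := by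
  ext i
  have : (Nat.land a b).testBit i = (a.testBit i && b.testBit i) := Nat.testBit_and a b i
  simp only [D, mem_filter, mem_inter, this, Bool.and_eq_true]
  tauto

set_option maxRecDepth 100000 in
theorem one_D : ∀ x < 512, one x = decide ((D x).card = 1) := by decide +kernel
set_option maxRecDepth 100000 in
theorem zer_D : ∀ x < 512, zer x = decide ((D x).card = 0) := by decide +kernel
set_option maxRecDepth 100000 in
theorem tri_lt : ∀ m ∈ tri, m < 512 ∧ (D m).card = 3 := by decide +kernel
set_option maxRecDepth 100000 in
theorem tri_surj : ∀ s ∈ powersetCard 3 (range 9), (∑ i ∈ s, 2 ^ i) ∈ tri ∧ D (∑ i ∈ s, 2 ^ i) = s := by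
  decide +kernel

/-- `H` has five distinguished vertices exhibiting it inside the `k`-th extremal graph. -/
def Covered (H : ThreeGraph) : Prop :=
  ∃ k v0 v1 v2 v3 v4, [v0, v1, v2, v3, v4].Nodup ∧ (∀ x ∈ [v0, v1, v2, v3, v4], x ∈ H.verts) ∧
    ∀ e ∈ H.edges, tst k (decide (v0 ∈ e)) (decide (v1 ∈ e)) (decide (v2 ∈ e))
      (decide (v3 ∈ e)) (decide (v4 ∈ e)) = true

def PathS (A B C : Finset ℕ) : Prop := (A ∩ B).card = 1 ∧ (B ∩ C).card = 1 ∧ (A ∩ C).card = 0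
def TriS (A B C : Finset ℕ) : Prop :=
  (A ∩ B).card = 1 ∧ (A ∩ C).card = 1 ∧ (B ∩ C).card = 1 ∧ (A ∩ B ∩ C).card = 0

theorem D_sub (m : ℕ) : D m ⊆ range 9 := filter_subset _ _

theorem img_inter {g : ℕ → ℕ} (hg : Set.InjOn g ↑(range 9)) {s t : Finset ℕ}
    (hs : s ⊆ range 9) (ht : t ⊆ range 9) : s.image g ∩ t.image g = (s ∩ t).image g := by
  rw [image_inter_of_injOn]
  refine hg.mono ?_
  intro x hx
  rcases hx with h | h
  · exact hs h
  · exact ht h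

theorem img_card {g : ℕ → ℕ} (hg : Set.InjOn g ↑(range 9)) {s : Finset ℕ}
    (hs : s ⊆ range 9) : (s.image g).card = s.card :=
  card_image_of_injOn (hg.mono (by exact_mod_cast hs))

theorem one_img {g : ℕ → ℕ} (hg : Set.InjOn g ↑(range 9)) {a b : ℕ} (ha : a < 512) :
    one (Nat.land a b) = decide (((D a).image g ∩ (D b).image g).card = 1) := by
  rw [img_inter hg (D_sub a) (D_sub b), img_card hg (inter_subset_left.trans (D_sub a)), ← D_land]
  exact one_D _ (lt_of_le_of_lt Nat.and_le_left ha)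

theorem zer_img {g : ℕ → ℕ} (hg : Set.InjOn g ↑(range 9)) {a b : ℕ} (ha : a < 512) :
    zer (Nat.land a b) = decide (((D a).image g ∩ (D b).image g).card = 0) := by
  rw [img_inter hg (D_sub a) (D_sub b), img_card hg (inter_subset_left.trans (D_sub a)), ← D_land]
  exact zer_D _ (lt_of_le_of_lt Nat.and_le_left ha)

theorem zer_img3 {g : ℕ → ℕ} (hg : Set.InjOn g ↑(range 9)) {a b c : ℕ} (ha : a < 512) :
    zer (Nat.land (Nat.land a b) c) =
      decide (((D a).image g ∩ (D b).image g ∩ (D c).image g).card = 0) := by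
  rw [img_inter hg (D_sub a) (D_sub b), ← D_land]
  exact zer_img hg (lt_of_le_of_lt Nat.and_le_left ha)

theorem isP_aux (x y w : ℕ) (p1 : ¬ (x = 1 ∧ w = 1 ∧ y = 0)) (p2 : ¬ (y = 1 ∧ w = 1 ∧ x = 0))
    (p3 : ¬ (x = 1 ∧ y = 1 ∧ w = 0)) :
    (bif decide (x = 0) then decide (y = 1) && decide (w = 1)
    else bif decide (x = 1) then
      (decide (y = 0) && decide (w = 1)) || (decide (w = 0) && decide (y = 1))
    else false) = false := by
  by_cases hx0 : x = 0
  · subst hx0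
    simp only [decide_true, cond_true, Bool.and_eq_false_iff, decide_eq_false_iff_not]
    tauto
  · by_cases hx1 : x = 1
    · subst hx1
      simp only [one_ne_zero, decide_false, cond_false, decide_true, cond_true,
        Bool.or_eq_false_iff, Bool.and_eq_false_iff, decide_eq_false_iff_not]
      tauto
    · simp [hx0, hx1]

theorem from_start {H : ThreeGraph} (hv : H.IsValid) (h15 : 15 ≤ H.edges.card)
    (hP : ∀ A ∈ H.edges, ∀ B ∈ H.edges, ∀ C ∈ H.edges, ¬ PathS A B C)
    {g : ℕ → ℕ} (hg : Set.InjOn g ↑(range 9)) (himg : (range 9).image g = H.verts)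
    (bad : ℕ → ℕ → ℕ → Bool) (bad2 : ℕ → ℕ → Bool) (t : CT) (l : List ℕ)
    (hrun : start bad bad2 t l [] tri = true)
    (hl : ∀ m ∈ l, m ∈ tri ∧ (D m).image g ∈ H.edges)
    (hb : (bad = isP) ∨ (bad = badPC ∧
      ∀ A ∈ H.edges, ∀ B ∈ H.edges, ∀ C ∈ H.edges, ¬ TriS A B C))
    (hb2 : bad2 = noPair ∨ (bad2 = disjPair ∧ ∀ A ∈ H.edges, ∀ B ∈ H.edges, (A ∩ B).card ≠ 0) ∨
      (bad2 = smallPair ∧ ∀ A ∈ H.edges, ∀ B ∈ H.edges, (A ∩ B).card ≠ 0 ∧ (A ∩ B).card ≠ 1)) :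
    Covered H := by
  classical
  set S : Finset ℕ := tri.toFinset.filter (fun m => (D m).image g ∈ H.edges) with hS
  have memS : ∀ m, m ∈ S ↔ m ∈ tri ∧ (D m).image g ∈ H.edges := by
    intro m; simp [hS]
  have surj : ∀ e ∈ H.edges, ∃ m ∈ S, (D m).image g = e := by
    intro e he
    obtain ⟨hc, hsub⟩ := hv e he
    have him : ((range 9).filter (fun i => g i ∈ e)).image g = e := by
      ext x
      simp only [mem_image, mem_filter]
      constructor
      · rintro ⟨i, ⟨_, hi⟩, rfl⟩; exact hi
      · intro hx
        have := hsub hx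
        rw [← himg, mem_image] at this
        obtain ⟨i, hi, rfl⟩ := this
        exact ⟨i, ⟨hi, hx⟩, rfl⟩
    have hcard : ((range 9).filter (fun i => g i ∈ e)).card = 3 := by
      rw [← img_card hg (filter_subset _ _), him, hc]
    obtain ⟨h1, h2⟩ := tri_surj _ (mem_powersetCard.2 ⟨filter_subset _ _, hcard⟩)
    refine ⟨_, (memS _).2 ⟨h1, ?_⟩, ?_⟩
    · rw [h2, him]; exact he
    · rw [h2, him]
  have hcS : 15 ≤ S.card := by
    have : H.edges ⊆ S.image (fun m => (D m).image g) := by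
      intro e he
      obtain ⟨m, hm, h⟩ := surj e he
      exact mem_image.2 ⟨m, hm, h⟩
    exact h15.trans ((card_le_card this).trans card_image_le)
  have lt : ∀ m ∈ S, m < 512 := fun m hm => (tri_lt m ((memS m).1 hm).1).1
  have noP : ∀ a ∈ S, ∀ b ∈ S, ∀ c ∈ S, isP a b c = false := by
    intro a ha b hb c hc
    have hA := ((memS a).1 ha).2
    have hB := ((memS b).1 hb).2
    have hC := ((memS c).1 hc).2
    have p1 := hP _ hA _ hB _ hC
    have p2 := hP _ hA _ hC _ hB
    have p3 := hP _ hB _ hA _ hC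
    unfold isP
    rw [one_img hg (lt a ha), one_img hg (lt a ha), one_img hg (lt b hb),
      zer_img hg (lt a ha), zer_img hg (lt a ha), zer_img hg (lt b hb)]
    unfold PathS at p1 p2 p3
    rw [inter_comm (image g (D c)) (image g (D b))] at p2
    rw [inter_comm (image g (D b)) (image g (D a))] at p3
    generalize (image g (D a) ∩ image g (D b)).card = x at *
    generalize (image g (D a) ∩ image g (D c)).card = y at *
    generalize (image g (D b) ∩ image g (D c)).card = w at *
    exact isP_aux x y w p1 p2 p3
  have hbad : ∀ a ∈ S, ∀ b ∈ S, ∀ c ∈ S, bad a b c = false := by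
    rcases hb with rfl | ⟨rfl, hT⟩
    · exact noP
    · intro a ha b hb c hc
      unfold badPC
      rw [noP a ha b hb c hc, Bool.false_or]
      have := hT _ ((memS a).1 ha).2 _ ((memS b).1 hb).2 _ ((memS c).1 hc).2
      unfold isC
      rw [one_img hg (lt a ha), one_img hg (lt a ha), one_img hg (lt b hb), zer_img3 hg (lt a ha)]
      simpa [TriS] using this
  have hbad2 : ∀ a ∈ S, ∀ b ∈ S, bad2 a b = false := by
    intro a ha b hb
    have hA := ((memS a).1 ha).2
    have hB := ((memS b).1 hb).2
    rcases hb2 with rfl | ⟨rfl, h⟩ | ⟨rfl, h⟩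
    · rfl
    · unfold disjPair
      rw [zer_img hg (lt a ha)]
      exact decide_eq_false (h _ hA _ hB)
    · unfold smallPair
      rw [zer_img hg (lt a ha), one_img hg (lt a ha), decide_eq_false (h _ hA _ hB).1,
        decide_eq_false (h _ hA _ hB).2]
      rfl
  obtain ⟨k, v0, v1, v2, v3, v4, hok, ht⟩ := start_sound hbad hbad2 hcS t l [] tri hrun
    (fun m hm => (memS m).2 (hl m hm)) (by simp) (fun x hx => Or.inr ((memS x).1 hx).1)
  obtain ⟨hnd, hlt⟩ := of_decide_eq_true hok
  refine ⟨k, g v0, g v1, g v2, g v3, g v4, ?_, ?_, ?_⟩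
  · have : ([v0, v1, v2, v3, v4].map g).Nodup := by
      refine hnd.map_on ?_
      intro x hx y hy hxy
      exact hg (by simpa using hlt x hx) (by simpa using hlt y hy) hxy
    simpa using this
  · intro x hx
    have : x ∈ [v0, v1, v2, v3, v4].map g := by simpa using hx
    obtain ⟨i, hi, rfl⟩ := List.mem_map.1 this
    rw [← himg]
    exact mem_image_of_mem _ (mem_range.2 (hlt i hi))
  · intro e he
    obtain ⟨m, hm, rfl⟩ := surj e he
    have key : ∀ v < 9, decide (g v ∈ (D m).image g) = m.testBit v := by
      intro v hv
      rw [Bool.eq_iff_iff, decide_eq_true_iff, mem_image]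
      constructor
      · rintro ⟨i, hi, hiv⟩
        have := hg (by simpa using D_sub m hi) (by simpa using hv) hiv
        subst this
        exact (mem_filter.1 hi).2
      · intro h
        exact ⟨v, mem_filter.2 ⟨mem_range.2 hv, h⟩, rfl⟩
    rw [key v0 (hlt _ (by simp)), key v1 (hlt _ (by simp)), key v2 (hlt _ (by simp)),
      key v3 (hlt _ (by simp)), key v4 (hlt _ (by simp))]
    exact ht m hm

/-- A list of distinct vertices extends to an enumeration of a 9-element set. -/
theorem exists_enum {V : Finset ℕ} (hV : V.card = 9) {l : List ℕ} (hn : l.Nodup)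
    (hl : ∀ x ∈ l, x ∈ V) :
    ∃ L : List ℕ, (l ++ L).Nodup ∧ (l ++ L).length = 9 ∧ ∀ x, x ∈ l ++ L ↔ x ∈ V := by
  refine ⟨(V \ l.toFinset).toList, ?_, ?_, ?_⟩
  · rw [List.nodup_append]
    refine ⟨hn, nodup_toList _, ?_⟩
    intro a ha b hb hab
    subst hab
    simp at hb
    exact hb.2 ha
  · rw [List.length_append, length_toList, card_sdiff_of_subset, List.toFinset_card_of_nodup hn, hV]
    · have : l.toFinset ⊆ V := by intro x hx; exact hl x (by simpa using hx)
      have := card_le_card this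
      rw [List.toFinset_card_of_nodup hn, hV] at this
      omega
    · intro x hx; exact hl x (by simpa using hx)
  · intro x
    by_cases hx : x ∈ l
    · simp [hx, hl x hx]
    · simp [hx]

theorem exists_label {V : Finset ℕ} (hV : V.card = 9) {l : List ℕ} (hn : l.Nodup)
    (hl : ∀ x ∈ l, x ∈ V) :
    ∃ g : ℕ → ℕ, Set.InjOn g ↑(range 9) ∧ (range 9).image g = V ∧
      ∀ i (h : i < l.length), g i = l[i] := by
  obtain ⟨L, h1, h2, h3⟩ := exists_enum hV hn hl
  have hinj : Set.InjOn (fun i => (l ++ L).getD i 0) ↑(range 9) := by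
    intro i hi j hj hij
    have hi' : i < (l ++ L).length := by rw [h2]; simpa using hi
    have hj' : j < (l ++ L).length := by rw [h2]; simpa using hj
    simp only [List.getD_eq_getElem _ _ hi', List.getD_eq_getElem _ _ hj'] at hij
    exact (h1.getElem_inj_iff).1 hij
  refine ⟨fun i => (l ++ L).getD i 0, hinj, ?_, ?_⟩
  · apply eq_of_subset_of_card_le
    · intro x hx
      obtain ⟨i, hi, rfl⟩ := mem_image.1 hx
      have hi' : i < (l ++ L).length := by rw [h2]; simpa using hi
      simp only [List.getD_eq_getElem _ _ hi']
      exact (h3 _).1 (List.getElem_mem _)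
    · rw [card_image_of_injOn hinj, hV, card_range]
  · intro i h
    have hi' : i < (l ++ L).length := by rw [List.length_append]; omega
    simp only [List.getD_eq_getElem _ _ hi']
    exact List.getElem_append_left h

theorem third {A : Finset ℕ} (hA : A.card = 3) {x y : ℕ} (hx : x ∈ A) (hy : y ∈ A) (hxy : x ≠ y) :
    ∃ z, z ≠ x ∧ z ≠ y ∧ A = {x, z, y} := by
  have h1 : (A \ {x, y}).card = 1 := by
    rw [card_sdiff_of_subset (by intro w hw; simp at hw; rcases hw with rfl | rfl <;> assumption), hA,
      card_pair hxy]
  obtain ⟨z, hz⟩ := card_eq_one.1 h1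
  have hm : ∀ w, (w ∈ A ∧ w ≠ x ∧ w ≠ y) ↔ w = z := by
    intro w
    have := Finset.ext_iff.1 hz w
    simpa using this
  have hzz := (hm z).2 rfl
  refine ⟨z, hzz.2.1, hzz.2.2, ?_⟩
  ext w
  have := hm w
  simp only [mem_insert, mem_singleton]
  constructor
  · intro hw
    by_cases h1 : w = x
    · exact Or.inl h1
    · by_cases h2 : w = y
      · exact Or.inr (Or.inr h2)
      · exact Or.inr (Or.inl (this.1 ⟨hw, h1, h2⟩))
  · rintro (rfl | rfl | rfl)
    · exact hx
    · exact hzz.1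
    · exact hy

theorem two_others {A : Finset ℕ} (hA : A.card = 3) {x : ℕ} (hx : x ∈ A) :
    ∃ y z, y ≠ x ∧ z ≠ x ∧ y ≠ z ∧ A = {x, y, z} := by
  have : (A.erase x).card = 2 := by rw [card_erase_of_mem hx, hA]
  obtain ⟨y, z, hyz, h⟩ := card_eq_two.1 this
  have hy : y ∈ A.erase x := by rw [h]; simp
  have hz : z ∈ A.erase x := by rw [h]; simp
  exact ⟨y, z, ne_of_mem_erase hy, ne_of_mem_erase hz, hyz, by rw [← h, insert_erase hx]⟩

set_option maxRecDepth 100000 in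
theorem Dvals : D 7 = {0, 1, 2} ∧ D 28 = {2, 3, 4} ∧ D 49 = {4, 5, 0} ∧ D 56 = {3, 4, 5} := by
  decide +kernel
set_option maxRecDepth 100000 in
theorem trivals : 7 ∈ tri ∧ 28 ∈ tri ∧ 49 ∈ tri ∧ 56 ∈ tri := by decide +kernel

theorem mem_of_inter {A B : Finset ℕ} {p : ℕ} (h : A ∩ B = {p}) :
    ∀ w, (w ∈ A ∧ w ∈ B) ↔ w = p := by
  intro w
  rw [← mem_inter, h, mem_singleton]

theorem upper {H : ThreeGraph} (hv : H.IsValid) (h9 : H.verts.card = 9) (h15 : 15 ≤ H.edges.card)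
    (hP : ∀ A ∈ H.edges, ∀ B ∈ H.edges, ∀ C ∈ H.edges, ¬ PathS A B C) : Covered H := by
  by_cases hT : ∀ A ∈ H.edges, ∀ B ∈ H.edges, ∀ C ∈ H.edges, ¬ TriS A B C
  swap
  · push Not at hT
    obtain ⟨A, hA, B, hB, C, hC, hAB, hAC, hBC, hABC⟩ := hT
    obtain ⟨p2, h2⟩ := card_eq_one.1 hAB
    obtain ⟨p0, h0⟩ := card_eq_one.1 hAC
    obtain ⟨p4, h4⟩ := card_eq_one.1 hBC
    rw [card_eq_zero] at hABC
    have m2 := mem_of_inter h2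
    have m0 := mem_of_inter h0
    have m4 := mem_of_inter h4
    have mn : ∀ w, w ∈ A → w ∈ B → w ∈ C → False := by
      intro w a b c
      have : w ∈ A ∩ B ∩ C := by simp [a, b, c]
      rw [hABC] at this
      simp at this
    have a2 := (m2 p2).2 rfl
    have a0 := (m0 p0).2 rfl
    have a4 := (m4 p4).2 rfl
    have n02 : p0 ≠ p2 := by rintro rfl; exact mn _ a0.1 a2.2 a0.2
    have n24 : p2 ≠ p4 := by rintro rfl; exact mn _ a2.1 a2.2 a4.2
    have n40 : p4 ≠ p0 := by rintro rfl; exact mn _ a0.1 a4.1 a0.2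
    obtain ⟨p1, n10, n12, eA⟩ := third (hv A hA).1 a0.1 a2.1 n02
    obtain ⟨p3, n32, n34, eB⟩ := third (hv B hB).1 a2.2 a4.1 n24
    obtain ⟨p5, n54, n50, eC⟩ := third (hv C hC).1 a4.2 a0.2 n40
    have b1 : p1 ∈ A := by rw [eA]; simp
    have b3 : p3 ∈ B := by rw [eB]; simp
    have b5 : p5 ∈ C := by rw [eC]; simp
    obtain ⟨g, hg, himg, hgl⟩ := exists_label h9 (l := [p0, p1, p2, p3, p4, p5])
      (by
        have n13 : p1 ≠ p3 := by rintro rfl; exact n12 ((m2 _).1 ⟨b1, b3⟩)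
        have n15 : p1 ≠ p5 := by rintro rfl; exact n10 ((m0 _).1 ⟨b1, b5⟩)
        have n35 : p3 ≠ p5 := by rintro rfl; exact n34 ((m4 _).1 ⟨b3, b5⟩)
        have n14 : p1 ≠ p4 := by rintro rfl; exact mn _ b1 a4.1 a4.2
        have n30 : p3 ≠ p0 := by rintro rfl; exact mn _ a0.1 b3 a0.2
        have n52 : p5 ≠ p2 := by rintro rfl; exact mn _ a2.1 a2.2 b5
        simp only [List.nodup_cons, List.mem_cons, List.not_mem_nil, or_false, not_or,
          List.nodup_nil, not_false_eq_true, and_true]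
        simp only [ne_eq, eq_comm] at *
        tauto)
      (by
        have sA := (hv A hA).2
        have sB := (hv B hB).2
        have sC := (hv C hC).2
        simp only [List.mem_cons, List.not_mem_nil, or_false]
        rintro x (rfl | rfl | rfl | rfl | rfl | rfl)
        · exact sA a0.1
        · exact sA b1
        · exact sA a2.1
        · exact sB b3
        · exact sB a4.1
        · exact sC b5)
    have g0 : g 0 = p0 := hgl 0 (by simp)
    have g1 : g 1 = p1 := hgl 1 (by simp)
    have g2 : g 2 = p2 := hgl 2 (by simp)
    have g3 : g 3 = p3 := hgl 3 (by simp)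
    have g4 : g 4 = p4 := hgl 4 (by simp)
    have g5 : g 5 = p5 := hgl 5 (by simp)
    refine from_start hv h15 hP hg himg isP noPair t1 _ run1 ?_ (Or.inl rfl) (Or.inl rfl)
    simp only [List.mem_cons, List.not_mem_nil, or_false]
    rintro m (rfl | rfl | rfl)
    · refine ⟨trivals.1, ?_⟩
      rw [Dvals.1]
      simpa [image_insert, g0, g1, g2, ← eA] using hA
    · refine ⟨trivals.2.1, ?_⟩
      rw [Dvals.2.1]
      simpa [image_insert, g3, g4, g2, ← eB] using hB
    · refine ⟨trivals.2.2.1, ?_⟩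
      rw [Dvals.2.2.1]
      simpa [image_insert, g0, g4, g5, ← eC] using hC
  by_cases hM : ∀ A ∈ H.edges, ∀ B ∈ H.edges, (A ∩ B).card ≠ 0
  swap
  · push Not at hM
    obtain ⟨A, hA, B, hB, hAB⟩ := hM
    obtain ⟨p0, p1, p2, n01, n02, n12, eA⟩ := card_eq_three.1 (hv A hA).1
    obtain ⟨p3, p4, p5, n34, n35, n45, eB⟩ := card_eq_three.1 (hv B hB).1
    have sA := (hv A hA).2
    have sB := (hv B hB).2
    rw [card_eq_zero, ← disjoint_iff_inter_eq_empty, eA, eB] at hAB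
    obtain ⟨g, hg, himg, hgl⟩ := exists_label h9 (l := [p0, p1, p2, p3, p4, p5])
      (by
        simp only [disjoint_insert_left, disjoint_singleton_left, mem_insert, mem_singleton,
          not_or] at hAB
        simp only [List.nodup_cons, List.mem_cons, List.not_mem_nil, or_false, not_or,
          List.nodup_nil, not_false_eq_true, and_true]
        tauto)
      (by
        rw [eA] at sA
        rw [eB] at sB
        simp only [List.mem_cons, List.not_mem_nil, or_false]
        rintro x (rfl | rfl | rfl | rfl | rfl | rfl)
        · exact sA (by simp)
        · exact sA (by simp)
        · exact sA (by simp)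
        · exact sB (by simp)
        · exact sB (by simp)
        · exact sB (by simp))
    have g0 : g 0 = p0 := hgl 0 (by simp)
    have g1 : g 1 = p1 := hgl 1 (by simp)
    have g2 : g 2 = p2 := hgl 2 (by simp)
    have g3 : g 3 = p3 := hgl 3 (by simp)
    have g4 : g 4 = p4 := hgl 4 (by simp)
    have g5 : g 5 = p5 := hgl 5 (by simp)
    refine from_start hv h15 hP hg himg badPC noPair t2 _ run2 ?_ (Or.inr ⟨rfl, hT⟩) (Or.inl rfl)
    simp only [List.mem_cons, List.not_mem_nil, or_false]
    rintro m (rfl | rfl)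
    · refine ⟨trivals.1, ?_⟩
      rw [Dvals.1]
      simpa [image_insert, g0, g1, g2, ← eA] using hA
    · refine ⟨trivals.2.2.2, ?_⟩
      rw [Dvals.2.2.2]
      simpa [image_insert, g3, g4, g5, ← eB] using hB
  by_cases hQ : ∀ A ∈ H.edges, ∀ B ∈ H.edges, (A ∩ B).card ≠ 1
  swap
  · push Not at hQ
    obtain ⟨A, hA, B, hB, hAB⟩ := hQ
    obtain ⟨p2, h2⟩ := card_eq_one.1 hAB
    have m2 := mem_of_inter h2
    have a2 := (m2 p2).2 rfl
    obtain ⟨p0, p1, n02, n12, n01, eA⟩ := two_others (hv A hA).1 a2.1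
    obtain ⟨p3, p4, n32, n42, n34, eB⟩ := two_others (hv B hB).1 a2.2
    have b0 : p0 ∈ A := by rw [eA]; simp
    have b1 : p1 ∈ A := by rw [eA]; simp
    have b3 : p3 ∈ B := by rw [eB]; simp
    have b4 : p4 ∈ B := by rw [eB]; simp
    have eA' : ({p0, p1, p2} : Finset ℕ) = A := by
      rw [eA]; ext w; simp; tauto
    obtain ⟨g, hg, himg, hgl⟩ := exists_label h9 (l := [p0, p1, p2, p3, p4])
      (by
        have n03 : p0 ≠ p3 := by rintro rfl; exact n02 ((m2 _).1 ⟨b0, b3⟩)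
        have n04 : p0 ≠ p4 := by rintro rfl; exact n02 ((m2 _).1 ⟨b0, b4⟩)
        have n13 : p1 ≠ p3 := by rintro rfl; exact n12 ((m2 _).1 ⟨b1, b3⟩)
        have n14 : p1 ≠ p4 := by rintro rfl; exact n12 ((m2 _).1 ⟨b1, b4⟩)
        have n23 := n32.symm
        have n24 := n42.symm
        simp only [List.nodup_cons, List.mem_cons, List.not_mem_nil, or_false, not_or,
          List.nodup_nil, not_false_eq_true, and_true]
        tauto)
      (by
        have sA := (hv A hA).2
        have sB := (hv B hB).2
        simp only [List.mem_cons, List.not_mem_nil, or_false]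
        rintro x (rfl | rfl | rfl | rfl | rfl)
        · exact sA b0
        · exact sA b1
        · exact sA a2.1
        · exact sB b3
        · exact sB b4)
    have g0 : g 0 = p0 := hgl 0 (by simp)
    have g1 : g 1 = p1 := hgl 1 (by simp)
    have g2 : g 2 = p2 := hgl 2 (by simp)
    have g3 : g 3 = p3 := hgl 3 (by simp)
    have g4 : g 4 = p4 := hgl 4 (by simp)
    refine from_start hv h15 hP hg himg badPC disjPair t3 _ run3 ?_ (Or.inr ⟨rfl, hT⟩)
      (Or.inr (Or.inl ⟨rfl, hM⟩))
    simp only [List.mem_cons, List.not_mem_nil, or_false]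
    rintro m (rfl | rfl)
    · refine ⟨trivals.1, ?_⟩
      rw [Dvals.1]
      simpa [image_insert, g0, g1, g2, eA'] using hA
    · refine ⟨trivals.2.1, ?_⟩
      rw [Dvals.2.1]
      simpa [image_insert, g3, g4, g2, ← eB] using hB
  obtain ⟨A, hA⟩ : H.edges.Nonempty := card_pos.1 (by omega)
  obtain ⟨p0, p1, p2, n01, n02, n12, eA⟩ := card_eq_three.1 (hv A hA).1
  have sA := (hv A hA).2
  rw [eA] at sA
  obtain ⟨g, hg, himg, hgl⟩ := exists_label h9 (l := [p0, p1, p2]) (by simp [n01, n02, n12])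
    (by
      simp only [List.mem_cons, List.not_mem_nil, or_false]
      rintro x (rfl | rfl | rfl) <;> exact sA (by simp))
  have g0 : g 0 = p0 := hgl 0 (by simp)
  have g1 : g 1 = p1 := hgl 1 (by simp)
  have g2 : g 2 = p2 := hgl 2 (by simp)
  refine from_start hv h15 hP hg himg badPC smallPair t4 _ run4 ?_ (Or.inr ⟨rfl, hT⟩)
    (Or.inr (Or.inr ⟨rfl, fun A hA B hB => ⟨hM A hA B hB, hQ A hA B hB⟩⟩))
  simp only [List.mem_cons, List.not_mem_nil, or_false]
  rintro m rfl
  refine ⟨trivals.1, ?_⟩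
  rw [Dvals.1]
  simpa [image_insert, g0, g1, g2, ← eA] using hA

/-! ### From set configurations to copies -/

theorem noPath_of_free {H : ThreeGraph} (hv : H.IsValid) (hf : H.Free pathP) :
    ∀ A ∈ H.edges, ∀ B ∈ H.edges, ∀ C ∈ H.edges, ¬ PathS A B C := by
  rintro A hA B hB C hC ⟨h1, h2, h3⟩
  obtain ⟨p2, e2⟩ := card_eq_one.1 h1
  obtain ⟨p4, e4⟩ := card_eq_one.1 h2
  rw [card_eq_zero] at h3
  have m2 := mem_of_inter e2
  have m4 := mem_of_inter e4
  have mn : ∀ w, w ∈ A → w ∈ C → False := by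
    intro w a c
    have : w ∈ A ∩ C := by simp [a, c]
    rw [h3] at this
    simp at this
  have a2 := (m2 p2).2 rfl
  have a4 := (m4 p4).2 rfl
  have n24 : p2 ≠ p4 := by rintro rfl; exact mn _ a2.1 a4.2
  obtain ⟨p3, n32, n34, eB⟩ := third (hv B hB).1 a2.2 a4.1 n24
  obtain ⟨p0, p1, n02, n12, n01, eA⟩ := two_others (hv A hA).1 a2.1
  obtain ⟨p5, p6, n54, n64, n56, eC⟩ := two_others (hv C hC).1 a4.2
  have b0 : p0 ∈ A := by rw [eA]; simp
  have b1 : p1 ∈ A := by rw [eA]; simp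
  have b3 : p3 ∈ B := by rw [eB]; simp
  have b5 : p5 ∈ C := by rw [eC]; simp
  have b6 : p6 ∈ C := by rw [eC]; simp
  have hnd : [p0, p1, p2, p3, p4, p5, p6].Nodup := by
    have AC : ∀ x ∈ A, ∀ y ∈ C, x ≠ y := by rintro x hx y hy rfl; exact mn _ hx hy
    have n03 : p0 ≠ p3 := by rintro rfl; exact n02 ((m2 _).1 ⟨b0, b3⟩)
    have n13 : p1 ≠ p3 := by rintro rfl; exact n12 ((m2 _).1 ⟨b1, b3⟩)
    have n35 : p3 ≠ p5 := by rintro rfl; exact n34 ((m4 _).1 ⟨b3, b5⟩)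
    have n36 : p3 ≠ p6 := by rintro rfl; exact n34 ((m4 _).1 ⟨b3, b6⟩)
    have := AC _ b0 _ a4.2
    have := AC _ b0 _ b5
    have := AC _ b0 _ b6
    have := AC _ b1 _ a4.2
    have := AC _ b1 _ b5
    have := AC _ b1 _ b6
    have := AC _ a2.1 _ b5
    have := AC _ a2.1 _ b6
    have := n32.symm
    have := n54.symm
    have := n64.symm
    simp only [List.nodup_cons, List.mem_cons, List.not_mem_nil, or_false, not_or,
      List.nodup_nil, not_false_eq_true, and_true]
    tauto
  apply hf
  refine ⟨fun i => [p0, p1, p2, p3, p4, p5, p6].getD i 0, ?_, ?_, ?_⟩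
  · intro i hi j hj hij
    have bd : ∀ i ∈ (pathP.verts : Set ℕ), i < [p0, p1, p2, p3, p4, p5, p6].length := by
      intro i hi
      simp only [pathP, coe_insert, coe_singleton, Set.mem_insert_iff, Set.mem_singleton_iff] at hi
      simp only [List.length_cons, List.length_nil]
      omega
    simp only [List.getD_eq_getElem _ _ (bd i hi), List.getD_eq_getElem _ _ (bd j hj)] at hij
    exact (hnd.getElem_inj_iff).1 hij
  · have sA := (hv A hA).2
    have sB := (hv B hB).2
    have sC := (hv C hC).2
    intro v hv
    simp only [pathP, mem_insert, mem_singleton] at hv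
    rcases hv with rfl | rfl | rfl | rfl | rfl | rfl | rfl
    · exact sA b0
    · exact sA b1
    · exact sA a2.1
    · exact sB b3
    · exact sB a4.1
    · exact sC b5
    · exact sC b6
  · intro e he
    simp only [pathP, mem_insert, mem_singleton] at he
    rcases he with rfl | rfl | rfl
    · have : ({p0, p1, p2} : Finset ℕ) = A := by rw [eA]; ext w; simp; tauto
      simpa [image_insert, this] using hA
    · simpa [image_insert, ← eB] using hB
    · simpa [image_insert, ← eC] using hC

/-! ### From covers to embeddings -/

def cell (k : ℕ) (s : Finset ℕ) : Bool :=
  tst k (decide (0 ∈ s)) (decide (1 ∈ s)) (decide (2 ∈ s)) (decide (3 ∈ s)) (decide (4 ∈ s))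

set_option maxRecDepth 100000 in
theorem cell0 : ∀ s ∈ powersetCard 3 (range 9), cell 0 s = true → s ∈ (SS 9).edges := by
  decide +kernel
set_option maxRecDepth 100000 in
theorem cell1 : ∀ s ∈ powersetCard 3 (range 9), cell 1 s = true →
    s.image (fun i => 8 - i) ∈ ((KK 6).dUnion (KK 3)).edges := by decide +kernel
set_option maxRecDepth 100000 in
theorem cell2 : ∀ s ∈ powersetCard 3 (range 9), cell 2 s = true → s ∈ (G1 9).edges := by
  decide +kernel
set_option maxRecDepth 100000 in
theorem cell3 : ∀ s ∈ powersetCard 3 (range 9), cell 3 s = true → s ∈ (G2 9).edges := by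
  decide +kernel
set_option maxRecDepth 100000 in
theorem cell4 : ∀ s ∈ powersetCard 3 (range 9), cell 4 s = true → s ∈ (G3 9).edges := by
  decide +kernel
set_option maxRecDepth 100000 in
theorem dU_verts : ((KK 6).dUnion (KK 3)).verts = range 9 := by decide +kernel

theorem contained_of_covered {H : ThreeGraph} (hv : H.IsValid) (h9 : H.verts.card = 9)
    (hc : Covered H) : ∃ G ∈ L9, G.ContainsCopy H := by
  obtain ⟨k, v0, v1, v2, v3, v4, hnd, hV, ht⟩ := hc
  obtain ⟨L, h1, h2, h3⟩ := exists_enum h9 hnd hV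
  set M := [v0, v1, v2, v3, v4] ++ L with hM
  have hlt : ∀ v ∈ H.verts, M.idxOf v < 9 := by
    intro v hv
    rw [← h2]
    exact List.idxOf_lt_length_iff.2 ((h3 v).2 hv)
  have hinj : Set.InjOn (fun v => M.idxOf v) ↑H.verts := by
    intro x hx y hy hxy
    exact (List.idxOf_inj ((h3 x).2 hx)).1 hxy
  have hset : ∀ e ∈ H.edges, e.image (fun v => M.idxOf v) ∈ powersetCard 3 (range 9) := by
    intro e he
    obtain ⟨hc, hs⟩ := hv e he
    rw [mem_powersetCard]
    refine ⟨?_, ?_⟩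
    · intro x hx
      obtain ⟨v, hv, rfl⟩ := mem_image.1 hx
      exact mem_range.2 (hlt v (hs hv))
    · rw [card_image_of_injOn (hinj.mono (by simpa using hs)), hc]
  have key : ∀ e ∈ H.edges, ∀ v ∈ H.verts, ∀ i, M.idxOf v = i →
      decide (i ∈ e.image (fun v => M.idxOf v)) = decide (v ∈ e) := by
    intro e he v hv' i hi
    subst hi
    rw [Bool.eq_iff_iff, decide_eq_true_iff, decide_eq_true_iff, mem_image]
    constructor
    · rintro ⟨w, hw, hwv⟩
      have := hinj ((hv e he).2 hw) hv' hwv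
      exact this ▸ hw
    · intro h
      exact ⟨v, h, rfl⟩
  have hcell : ∀ e ∈ H.edges, cell k (e.image (fun v => M.idxOf v)) = true := by
    intro e he
    have idx : ∀ (i : ℕ) (h : i < M.length), M.idxOf (M[i]) = i := fun i h =>
      h1.idxOf_getElem i h
    unfold cell
    rw [key e he v0 (hV _ (by simp)) 0 (idx 0 (by omega)),
      key e he v1 (hV _ (by simp)) 1 (idx 1 (by omega)),
      key e he v2 (hV _ (by simp)) 2 (idx 2 (by omega)),
      key e he v3 (hV _ (by simp)) 3 (idx 3 (by omega)),
      key e he v4 (hV _ (by simp)) 4 (idx 4 (by omega))]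
    exact ht e he
  match k, hcell with
  | 0, hcell => exact ⟨SS 9, by simp [L9], _, hinj, fun v hv => mem_range.2 (hlt v hv),
      fun e he => cell0 _ (hset e he) (hcell e he)⟩
  | 1, hcell =>
    refine ⟨(KK 6).dUnion (KK 3), by simp [L9], fun v => 8 - M.idxOf v, ?_, ?_, ?_⟩
    · intro x hx y hy hxy
      have hx' := hlt x hx
      have hy' := hlt y hy
      apply hinj hx hy
      simp only at hxy ⊢
      omega
    · intro v hv
      rw [dU_verts, mem_range]
      show 8 - M.idxOf v < 9
      omega
    · intro e he
      have := cell1 _ (hset e he) (hcell e he)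
      rw [image_image] at this
      exact this
  | 2, hcell => exact ⟨G1 9, by simp [L9], _, hinj, fun v hv => mem_range.2 (hlt v hv),
      fun e he => cell2 _ (hset e he) (hcell e he)⟩
  | 3, hcell => exact ⟨G2 9, by simp [L9], _, hinj, fun v hv => mem_range.2 (hlt v hv),
      fun e he => cell3 _ (hset e he) (hcell e he)⟩
  | 4, hcell => exact ⟨G3 9, by simp [L9], _, hinj, fun v hv => mem_range.2 (hlt v hv),
      fun e he => cell4 _ (hset e he) (hcell e he)⟩
  | (n + 5), hcell =>
    exact ⟨SS 9, by simp [L9], _, hinj, fun v hv => mem_range.2 (hlt v hv),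
      fun e he => absurd (hcell e he) (by simp [cell, tst])⟩

/-! ### The lower bound: `K_5` with four pendant edges -/

set_option maxRecDepth 100000 in
theorem K5_valid : (K5plus 4).IsValid := by
  unfold ThreeGraph.IsValid
  decide +kernel
set_option maxRecDepth 100000 in
theorem K5_card : (K5plus 4).edges.card = 14 := by decide +kernel
set_option maxRecDepth 100000 in
theorem K5_noPath : ∀ A ∈ (K5plus 4).edges, ∀ B ∈ (K5plus 4).edges, (A ∩ B).card = 1 →
    ∀ C ∈ (K5plus 4).edges, (B ∩ C).card = 1 → (A ∩ C).card ≠ 0 := by decide +kernel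
set_option maxRecDepth 100000 in
theorem K5_sub : powersetCard 3 (range 5) ⊆ (K5plus 4).edges := by decide +kernel
set_option maxRecDepth 100000 in
theorem K5_pend : ∀ v < 9, 5 ≤ v → {0, 1, v} ∈ (K5plus 4).edges := by decide +kernel

theorem K5_free : (K5plus 4).Free pathP := by
  rintro ⟨f, hf, -, he⟩
  have hi : ∀ s t : Finset ℕ, s ⊆ pathP.verts → t ⊆ pathP.verts →
      (s.image f ∩ t.image f).card = (s ∩ t).card := by
    intro s t hs ht
    rw [← image_inter_of_injOn, card_image_of_injOn]
    · exact hf.mono (by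
        intro x hx
        exact hs (mem_inter.1 (mem_coe.1 hx)).1)
    · refine hf.mono ?_
      intro x hx
      rcases hx with h | h
      · exact hs h
      · exact ht h
  have e1 := he {0, 1, 2} (by decide)
  have e2 := he {2, 3, 4} (by decide)
  have e3 := he {4, 5, 6} (by decide)
  refine K5_noPath _ e1 _ e2 ?_ _ e3 ?_ ?_
  · rw [hi _ _ (by decide) (by decide)]; decide
  · rw [hi _ _ (by decide) (by decide)]; decide
  · rw [hi _ _ (by decide) (by decide)]; decide

theorem K5_image {G : ThreeGraph} {f : ℕ → ℕ} (hG : G.verts = range 9)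
    (hf : Set.InjOn f ↑(K5plus 4).verts) (hv : ∀ v ∈ (K5plus 4).verts, f v ∈ G.verts)
    (he : ∀ e ∈ (K5plus 4).edges, e.image f ∈ G.edges) :
    (range 5).image f ∈ powersetCard 5 (range 9) ∧
      powersetCard 3 ((range 5).image f) ⊆ G.edges := by
  have h59 : (range 5 : Finset ℕ) ⊆ (K5plus 4).verts := by decide
  have hf5 : Set.InjOn f ↑(range 5) := hf.mono (by exact_mod_cast h59)
  constructor
  · rw [mem_powersetCard]
    constructor
    · intro x hx
      obtain ⟨v, hv', rfl⟩ := mem_image.1 hx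
      rw [← hG]
      exact hv v (h59 hv')
    · rw [card_image_of_injOn hf5, card_range]
  · intro s hs
    obtain ⟨hs1, hs2⟩ := mem_powersetCard.1 hs
    obtain ⟨t, ht, rfl⟩ := subset_image_iff.1 hs1
    apply he
    apply K5_sub
    rw [mem_powersetCard]
    refine ⟨by exact_mod_cast ht, ?_⟩
    rwa [card_image_of_injOn (hf5.mono (by exact_mod_cast ht))] at hs2

set_option maxRecDepth 100000 in
theorem no_K5_SS : ∀ W ∈ powersetCard 5 (range 9), ¬ powersetCard 3 W ⊆ (SS 9).edges := by
  decide +kernel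
set_option maxRecDepth 100000 in
theorem no_K5_G1 : ∀ W ∈ powersetCard 5 (range 9), ¬ powersetCard 3 W ⊆ (G1 9).edges := by
  decide +kernel
set_option maxRecDepth 100000 in
theorem no_K5_G2 : ∀ W ∈ powersetCard 5 (range 9), ¬ powersetCard 3 W ⊆ (G2 9).edges := by
  decide +kernel
set_option maxRecDepth 100000 in
theorem no_K5_G3 : ∀ W ∈ powersetCard 5 (range 9), ¬ powersetCard 3 W ⊆ (G3 9).edges := by
  decide +kernel
set_option maxRecDepth 100000 in
theorem K5_dU : ∀ W ∈ powersetCard 5 (range 9),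
    powersetCard 3 W ⊆ ((KK 6).dUnion (KK 3)).edges → W ⊆ range 6 := by
  decide +kernel
set_option maxRecDepth 100000 in
theorem dU_8 : ∀ p < 6, ∀ q < 6, {p, q, 8} ∉ ((KK 6).dUnion (KK 3)).edges := by
  decide +kernel

theorem K5_not_contained : ∀ G ∈ L9, ¬ G.ContainsCopy (K5plus 4) := by
  intro G hG
  simp only [L9, List.mem_cons, List.not_mem_nil, or_false] at hG
  rcases hG with rfl | rfl | rfl | rfl | rfl
  · rintro ⟨f, hf, hv, he⟩
    obtain ⟨a, b⟩ := K5_image rfl hf hv he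
    exact no_K5_SS _ a b
  · rintro ⟨f, hf, hv, he⟩
    obtain ⟨a, b⟩ := K5_image dU_verts hf hv he
    have hW := K5_dU _ a b
    have hsurj : (K5plus 4).verts.image f = range 9 := by
      apply eq_of_subset_of_card_le
      · intro x hx
        obtain ⟨v, hv', rfl⟩ := mem_image.1 hx
        rw [← dU_verts]
        exact hv v hv'
      · rw [card_image_of_injOn hf]
        decide
    have h8 : 8 ∈ (K5plus 4).verts.image f := by rw [hsurj]; decide
    obtain ⟨v, hv', hv8⟩ := mem_image.1 h8
    have hv9 : v < 9 := mem_range.1 hv'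
    have lt6 : ∀ u < 5, f u < 6 := fun u hu =>
      mem_range.1 (hW (mem_image_of_mem f (mem_range.2 hu)))
    have hv5 : 5 ≤ v := by
      by_contra h
      have := lt6 v (by omega)
      omega
    have := he _ (K5_pend v hv9 hv5)
    refine dU_8 (f 0) (lt6 0 (by omega)) (f 1) (lt6 1 (by omega)) ?_
    simpa [image_insert, hv8] using this
  · rintro ⟨f, hf, hv, he⟩
    obtain ⟨a, b⟩ := K5_image rfl hf hv he
    exact no_K5_G1 _ a b
  · rintro ⟨f, hf, hv, he⟩
    obtain ⟨a, b⟩ := K5_image rfl hf hv he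
    exact no_K5_G2 _ a b
  · rintro ⟨f, hf, hv, he⟩
    obtain ⟨a, b⟩ := K5_image rfl hf hv he
    exact no_K5_G3 _ a b

end Turan9

/-- The maximum number of edges of a `P`-free 3-graph on 9 vertices not contained
in any member of `L₉` equals 14. -/
theorem fifth_order_turan_nine :
    IsGreatest {m : ℕ | ∃ H : ThreeGraph, H.IsValid ∧ H.verts.card = 9 ∧
      H.Free pathP ∧ (∀ G ∈ L9, ¬ G.ContainsCopy H) ∧ H.edges.card = m} 14 := by
  refine ⟨⟨K5plus 4, Turan9.K5_valid, by decide, Turan9.K5_free, Turan9.K5_not_contained,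
    Turan9.K5_card⟩, ?_⟩
  rintro m ⟨H, hv, h9, hf, hL, rfl⟩
  by_contra h
  obtain ⟨G, hG, hc⟩ := Turan9.contained_of_covered hv h9
    (Turan9.upper hv h9 (by omega) (Turan9.noPath_of_free hv hf))
  exact hL G hG hc
end
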